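/- arXiv:2310.04661 — 2 statements merged into one kernel-verified Lean document; each statement's English description precedes it below -/
import Mathlib

section
/- Let A and B be differential operators on a differential superalgebra V, both of order at most N. Then for indeterminates λ, z, w, the expression A(z)·ι_z(z-w-λ-∂)^{-1}(B(w)) - A(∂+λ+w)·ι_z(z-w-λ-∂)^{-1}(B*(λ-z)) equals Σ_{i,j=0}^{N-1} z^i w^j Res( (A(∂+λ)(∂+λ)^{-i-1})_+ B(∂) ∂^{-j-1} - A(∂+λ)((∂+λ)^{-i-1}B(∂))_+ ∂^{-j-1} ). In particular, this expression is a polynomial in z and w of degree at most N-1 in each variable. -/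
noncomputable section

/-- A differential superalgebra: a `ℤ/2`-graded associative unital `ℂ`-algebra,
supercommutative, with an even derivation `D`. -/
class DiffSuperAlg (V : Type*) extends Ring V, Algebra ℂ V where
  grading : ZMod 2 → Submodule ℂ V
  gradedAlgebra : GradedAlgebra grading
  D : V → V
  superComm : ∀ (i j : ZMod 2), ∀ a ∈ grading i, ∀ b ∈ grading j,
      a * b = ((-1 : ℂ) ^ (i.val * j.val)) • (b * a)
  D_add : ∀ a b, D (a + b) = D a + D b
  D_smul : ∀ (c : ℂ) (a : V), D (c • a) = c • D a
  D_mul : ∀ a b, D (a * b) = D a * b + a * D b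
  D_even : ∀ (i : ZMod 2), ∀ a ∈ grading i, D a ∈ grading i

namespace PDO

variable {V : Type*} [DiffSuperAlg V]

/-- Iterated derivation `∂ⁿ`. -/
def Dit (n : ℕ) : V → V := (DiffSuperAlg.D (V := V))^[n]

/-- Generalized binomial coefficient `C(k, n)` for `k ∈ ℤ`. -/
def cchoose (k : ℤ) (n : ℕ) : ℂ :=
  (∏ i ∈ Finset.range n, ((k : ℂ) - (i : ℂ))) / (n.factorial : ℂ)

/-- Sign `(-1)^x` of a parity `x ∈ ℤ/2`. -/
def sgn (x : ZMod 2) : ℂ := (-1 : ℂ) ^ x.val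

/-- A formal series `Σₖ (f k) ∂ᵏ` is an honest pseudo-differential operator when its
support is bounded above. -/
def IsPDO (f : ℤ → V) : Prop := ∃ N : ℤ, ∀ k : ℤ, N < k → f k = 0

/-- `f` is monic of order `N`. -/
def IsMonic (f : ℤ → V) (N : ℤ) : Prop :=
  f N = 1 ∧ ∀ k : ℤ, N < k → f k = 0

/-- `f` is a differential operator of order at most `N`. -/
def IsDiffOpLE (f : ℤ → V) (N : ℕ) : Prop := ∀ k : ℤ, f k ≠ 0 → 0 ≤ k ∧ k ≤ (N : ℤ)

/-- All coefficients of `f` are homogeneous of parity `π`. -/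
def IsHomog (f : ℤ → V) (π : ZMod 2) : Prop :=
  ∀ k : ℤ, f k ∈ DiffSuperAlg.grading (V := V) π

/-- The product of pseudo-differential operators, obtained from the rule
`∂ᵏ v = Σₙ C(k,n) v⁽ⁿ⁾ ∂^(k-n)`. -/
def pmul (f g : ℤ → V) : ℤ → V := fun m =>
  ∑ᶠ (k : ℤ) (j : ℤ) (n : ℕ),
    if m = k + j - (n : ℤ) then cchoose k n • (f k * Dit n (g j)) else 0

/-- The identity operator. -/
def one : ℤ → V := fun m => if m = 0 then 1 else 0

/-- The operator `∂^e`. -/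
def del (e : ℤ) : ℤ → V := fun m => if m = e then 1 else 0

/-- The adjoint `A*(∂) = Σₖ (-∂)ᵏ aₖ`, coefficientwise. -/
def adj (f : ℤ → V) : ℤ → V := fun m =>
  ∑ᶠ n : ℕ, ((-1 : ℂ) ^ (m + (n : ℤ)) * cchoose (m + n) n) • Dit n (f (m + n))

/-- The residue `Res A = a₋₁`. -/
def res (f : ℤ → V) : V := f (-1)

/-- The differential part `A₊`. -/
def dplus (f : ℤ → V) : ℤ → V := fun k => if 0 ≤ k then f k else 0

/-- Coefficient of `z^m` in `A(z+∂)(B(z))`, where `(z+∂)⁻¹` is expanded as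
`Σₙ (-1)ⁿ z^(-n-1) ∂ⁿ` (i.e. via the generalized binomial coefficients). -/
def symbolSub (f g : ℤ → V) : ℤ → V := fun m =>
  ∑ᶠ (k : ℤ) (n : ℕ), cchoose k n • (f k * Dit n (g (m - k + n)))

/-- Coefficientwise derivation on `V[λ]`. -/
def Dp (P : Polynomial V) : Polynomial V :=
  P.sum fun n c => Polynomial.C (DiffSuperAlg.D c) * Polynomial.X ^ n

/-- Iterated coefficientwise derivation on `V[λ]`. -/
def DpIt (n : ℕ) : Polynomial V → Polynomial V := (Dp (V := V))^[n]

/-- Coefficient of `w^j` in `(w+λ+∂)ⁿ (G(w))`, where `G(w) = Σ_q g_q w^q`. -/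
def expW (n : ℕ) (g : ℤ → V) (j : ℤ) : Polynomial V :=
  ∑ᶠ (m : ℕ) (α : ℕ), if m + α ≤ n then
    (((n.choose m) * ((n - m).choose α) : ℕ) : ℂ) •
      ((Polynomial.X : Polynomial V) ^ (n - m - α) * Polynomial.C (Dit m (g (j - (α : ℤ)))))
  else 0

/-- Coefficient of `z^i w^j` in `A(z) ι_z(z-w-λ-∂)⁻¹ (B(w))`. -/
def iotaTermB (f g : ℤ → V) (i j : ℤ) : Polynomial V :=
  ∑ᶠ n : ℕ, Polynomial.C (f (i + n + 1)) * expW n g j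

/-- `A(w+λ+∂)` applied to `P ∈ V[λ]`: coefficient of `w^j`. -/
def appW (f : ℤ → V) (P : Polynomial V) (j : ℤ) : Polynomial V :=
  ∑ᶠ (n : ℕ) (β : ℕ),
    (cchoose (j + n + β) n * cchoose (j + β) β) •
      ((Polynomial.X : Polynomial V) ^ β * (Polynomial.C (f (j + n + β)) * DpIt n P))

/-- Symbol of the adjoint `A*` at `λ - z` (expanded for large `|z|`):
coefficient of `z^i`, as an element of `V[λ]`. -/
def adjSymb (g : ℤ → V) (i : ℤ) : Polynomial V :=
  ∑ᶠ β : ℕ, ((-1 : ℂ) ^ i * cchoose (i + β) β) •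
    ((Polynomial.X : Polynomial V) ^ β * Polynomial.C (adj g (i + β)))

/-- Coefficient of `z^i w^j` in `A(w+λ+∂) ι_z(z-w-λ-∂)⁻¹ ((B)*(λ-z))`. -/
def iotaTermA (f g : ℤ → V) (i j : ℤ) : Polynomial V :=
  ∑ᶠ n : ℕ, appW (fun k => f (k - n)) (adjSymb g (i + n + 1)) j

/-- Coefficient of `z^i w^j` of the right-hand side
`A(w+λ+∂) ι_z(z-w-λ-∂)⁻¹ (B*)(λ-z) - A(z) ι_z(z-w-λ-∂)⁻¹ B(w)`
of the super Adler identity, for the entries `f = A_{hj}` and `g = A_{ik}`. -/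
def adlerRHS (f g : ℤ → V) (i j : ℤ) : Polynomial V :=
  iotaTermA f g i j - iotaTermB f g i j

/-- Coefficient of `w^j` in `A(w+λ)`. -/
def symbLam (f : ℤ → V) (j : ℤ) : Polynomial V :=
  ∑ᶠ β : ℕ, cchoose (j + β) β •
    ((Polynomial.X : Polynomial V) ^ β * Polynomial.C (f (j + β)))

variable {I : Type*} [Fintype I] [DecidableEq I]

/-- The super Adler-type operator property of a matrix pseudo-differential operator,
with respect to a λ-bracket `Br` and the parity function `p` on the index set. -/
def IsSATO (p : I → ZMod 2) (Br : V → V → Polynomial V) (A : I → I → ℤ → V) : Prop :=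
  ∀ i j h k : I, ∀ zp wp : ℤ,
    Br (A i j zp) (A h k wp) =
      sgn (p i * p j + p i * p h + p j * p h) • adlerRHS (A h j) (A i k) zp wp

/-- Homogeneous component of parity `π` of an element of `V`. -/
def gpart (π : ZMod 2) (v : V) : V :=
  letI := DiffSuperAlg.gradedAlgebra (V := V)
  ((DirectSum.decompose (DiffSuperAlg.grading (V := V)) v) π : V)

/-- The `∘`-product `(a⊗v)∘(b⊗w) = (-1)^(|b||v|) ab⊗vw` on matrix pseudo-differential
operators. -/
def circMul (p : I → ZMod 2) (M N : I → I → ℤ → V) : I → I → ℤ → V :=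
  fun i j m => ∑ t : I, ∑ π : ZMod 2,
    sgn ((p t + p j) * π) • pmul (fun k => gpart π (M i t k)) (N t j) m

/-- The `⋆`-product `(a⊗v)⋆(b⊗w) = (-1)^(|b||v|+|a||b|) ab⊗vw` on matrix
pseudo-differential operators. -/
def starMul (p : I → ZMod 2) (M N : I → I → ℤ → V) : I → I → ℤ → V :=
  fun i j m => ∑ t : I, ∑ π : ZMod 2,
    sgn ((p t + p j) * π + (p i + p t) * (p t + p j)) •
      pmul (fun k => gpart π (M i t k)) (N t j) m

/-- The identity matrix operator `𝟙_I`. -/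
def idMat : I → I → ℤ → V := fun i j m => if i = j ∧ m = 0 then 1 else 0

/-- `M` is a monic matrix (pseudo-)differential operator of order `N`. -/
def IsMonicMat (M : I → I → ℤ → V) (N : ℤ) : Prop :=
  (∀ i j : I, M i j N = if i = j then (1 : V) else 0) ∧
  (∀ i j : I, ∀ k : ℤ, N < k → M i j k = 0)

/-- `∘`-powers of a matrix pseudo-differential operator. -/
def circPow (p : I → ZMod 2) (M : I → I → ℤ → V) : ℕ → I → I → ℤ → V
  | 0 => idMat
  | n + 1 => circMul p M (circPow p M n)

/-- Matrix-wise differential part. -/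
def dplusMat (M : I → I → ℤ → V) : I → I → ℤ → V := fun i j => dplus (M i j)

/-- `Res str M`, the supertrace of the residue. -/
def strRes (p : I → ZMod 2) (M : I → I → ℤ → V) : V :=
  ∑ i : I, sgn (p i) • res (M i i)

/-- `{a_(λ+∂) c}_→ b`, i.e. `Σₙ (a₍ₙ₎c) (λ+∂)ⁿ b` for `P = {a_λ c}`. -/
def lamShift (P : Polynomial V) (b : V) : Polynomial V :=
  ∑ᶠ (n : ℕ) (m : ℕ), if m ≤ n then ((n.choose m : ℕ) : ℂ) •
    ((Polynomial.X : Polynomial V) ^ (n - m) * Polynomial.C (P.coeff n * Dit m b)) else 0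

/-- `{b_(-λ-∂) a}` computed from `P = {b_λ a}`. -/
def negLam (P : Polynomial V) : Polynomial V :=
  ∑ᶠ (n : ℕ) (m : ℕ), if m ≤ n then (((n.choose m : ℕ) : ℂ) * (-1 : ℂ) ^ n) •
    ((Polynomial.X : Polynomial V) ^ (n - m) * Polynomial.C (Dit m (P.coeff n))) else 0

end PDO

/-- A λ-bracket on a differential superalgebra: even, bilinear, sesquilinear,
satisfying the left and right Leibniz rules. -/
structure LambdaBracket (V : Type*) [DiffSuperAlg V] where
  br : V → V → Polynomial V
  add_left : ∀ a b c : V, br (a + b) c = br a c + br b c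
  add_right : ∀ a b c : V, br a (b + c) = br a b + br a c
  smul_left : ∀ (r : ℂ) (a b : V), br (r • a) b = r • br a b
  smul_right : ∀ (r : ℂ) (a b : V), br a (r • b) = r • br a b
  even : ∀ (i j : ZMod 2), ∀ a ∈ DiffSuperAlg.grading (V := V) i,
      ∀ b ∈ DiffSuperAlg.grading (V := V) j, ∀ n : ℕ,
      (br a b).coeff n ∈ DiffSuperAlg.grading (V := V) (i + j)
  sesq_left : ∀ a b : V, br (DiffSuperAlg.D a) b = -(Polynomial.X * br a b)
  sesq_right : ∀ a b : V,
      br a (DiffSuperAlg.D b) = Polynomial.X * br a b + PDO.Dp (br a b)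
  leibniz_left : ∀ (i j : ZMod 2), ∀ a ∈ DiffSuperAlg.grading (V := V) i,
      ∀ b ∈ DiffSuperAlg.grading (V := V) j, ∀ c : V,
      br a (b * c) = br a b * Polynomial.C c + PDO.sgn (i * j) • (Polynomial.C b * br a c)
  leibniz_right : ∀ (i j k : ZMod 2), ∀ a ∈ DiffSuperAlg.grading (V := V) i,
      ∀ b ∈ DiffSuperAlg.grading (V := V) j, ∀ c ∈ DiffSuperAlg.grading (V := V) k,
      br (a * b) c =
        PDO.sgn (j * k) • PDO.lamShift (br a c) b +
        PDO.sgn (i * (j + k)) • PDO.lamShift (br b c) a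

namespace PDO

variable {V : Type*} [DiffSuperAlg V]

/-- Skew-symmetry axiom: `{a_λ b} = -(-1)^(|a||b|) {b_(-λ-∂) a}`. -/
def SkewSymm (B : LambdaBracket V) : Prop :=
  ∀ (i j : ZMod 2), ∀ a ∈ DiffSuperAlg.grading (V := V) i,
    ∀ b ∈ DiffSuperAlg.grading (V := V) j,
    B.br a b = -(sgn (i * j) • negLam (B.br b a))

/-- Coefficient of `λ^l μ^m` in `{{a_λ b}_(λ+μ) c}`. -/
def jacComp (B : LambdaBracket V) (a b c : V) (l m : ℕ) : V :=
  ∑ᶠ n : ℕ, if n ≤ l then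
    (((l - n + m).choose m : ℕ) : ℂ) • (B.br ((B.br a b).coeff n) c).coeff (l - n + m)
  else 0

/-- Jacobi identity: `{a_λ {b_μ c}} = {{a_λ b}_(λ+μ) c} + (-1)^(|a||b|) {b_μ {a_λ c}}`,
written on the coefficient of `λ^l μ^m`. -/
def Jacobi (B : LambdaBracket V) : Prop :=
  ∀ (i j : ZMod 2), ∀ a ∈ DiffSuperAlg.grading (V := V) i,
    ∀ b ∈ DiffSuperAlg.grading (V := V) j, ∀ c : V, ∀ l m : ℕ,
    (B.br a ((B.br b c).coeff m)).coeff l =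
      jacComp B a b c l m + sgn (i * j) • (B.br b ((B.br a c).coeff l)).coeff m

/-- The family `u` differentially generates `V`. -/
def diffGen (u : Set V) : Prop :=
  Algebra.adjoin ℂ {x : V | ∃ v ∈ u, ∃ n : ℕ, x = Dit n v} = ⊤

end PDO

namespace PDO

variable {V : Type*} [DiffSuperAlg V]

/-- Product of pseudo-differential operators with coefficients in `V[λ]`
(where `λ` is central and `∂` acts coefficientwise by `Dp`). -/
def pmulP (f g : ℤ → Polynomial V) : ℤ → Polynomial V := fun m =>
  ∑ᶠ (k : ℤ) (j : ℤ) (n : ℕ),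
    if m = k + j - (n : ℤ) then cchoose k n • (f k * DpIt n (g j)) else 0

/-- Residue over `V[λ]`. -/
def resP (f : ℤ → Polynomial V) : Polynomial V := f (-1)

/-- Differential part over `V[λ]`. -/
def dplusP (f : ℤ → Polynomial V) : ℤ → Polynomial V := fun k => if 0 ≤ k then f k else 0

/-- `∂^e` over `V[λ]`. -/
def delP (e : ℤ) : ℤ → Polynomial V := fun m => if m = e then 1 else 0

/-- Coefficients of `A(∂+λ)` as a pseudo-differential operator over `V[λ]`. -/
def shiftLam (f : ℤ → V) : ℤ → Polynomial V := fun m =>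
  ∑ᶠ n : ℕ, cchoose (m + n) n •
    ((Polynomial.X : Polynomial V) ^ n * Polynomial.C (f (m + n)))

/-- Coefficients of `(∂+λ)^e` as a pseudo-differential operator over `V[λ]`. -/
def powLam (e : ℤ) : ℤ → Polynomial V := fun m =>
  if m ≤ e then cchoose e (e - m).toNat • ((Polynomial.X : Polynomial V) ^ (e - m).toNat)
  else 0

/-- `B(∂)` viewed over `V[λ]`. -/
def constP (g : ℤ → V) : ℤ → Polynomial V := fun m => Polynomial.C (g m)

end PDO

namespace PDO

open Finset Polynomial

variable {V : Type*} [DiffSuperAlg V]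

section fin
variable {M : Type*} [AddCommMonoid M]

lemma fs_nat (F : ℕ → M) (K : ℕ) (h : ∀ n, K ≤ n → F n = 0) :
    ∑ᶠ n, F n = ∑ n ∈ range K, F n := by
  apply finsum_eq_sum_of_support_subset
  intro n hn
  simp only [coe_range, Set.mem_Iio]
  by_contra hc
  exact hn (h n (by omega))

lemma fs_int_nat (F : ℤ → M) (h : ∀ k : ℤ, k < 0 → F k = 0) :
    ∑ᶠ k, F k = ∑ᶠ n : ℕ, F n := by
  rw [← finsum_mem_range (f := F) (g := fun n : ℕ => (n : ℤ)) Nat.cast_injective]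
  apply finsum_congr
  intro k
  by_cases hk : k < 0
  · rw [h k hk]; simp
  · have : k ∈ Set.range (fun n : ℕ => (n : ℤ)) := ⟨k.toNat, by simp; omega⟩
    simp only [this, finsum_true]

lemma fs_int (F : ℤ → M) (K : ℕ) (h0 : ∀ k : ℤ, k < 0 → F k = 0)
    (h : ∀ k : ℤ, (K : ℤ) ≤ k → F k = 0) :
    ∑ᶠ k, F k = ∑ n ∈ range K, F n := by
  rw [fs_int_nat F h0, fs_nat _ K]
  intro n hn
  exact h _ (by exact_mod_cast hn)

lemma fs_shift (F : ℤ → M) (c : ℤ) : ∑ᶠ k, F k = ∑ᶠ k, F (c + k) :=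
  (finsum_comp_equiv (Equiv.addLeft c)).symm

lemma dbl (F : ℕ → ℕ → M) (K : ℕ) (h : ∀ a b, K ≤ a + b → F a b = 0) :
    ∑ᶠ a, ∑ᶠ b, F a b = ∑ s ∈ range K, ∑ x ∈ antidiagonal s, F x.1 x.2 := by
  have h1 : ∀ a, ∑ᶠ b, F a b = ∑ b ∈ range (K - a), F a b := fun a =>
    fs_nat _ _ (fun n hn => h a n (by omega))
  rw [fs_nat _ K]
  · simp only [h1]
    rw [Finset.sum_sigma', Finset.sum_sigma']
    refine Finset.sum_bij' (fun x _ => ⟨x.1 + x.2, (x.1, x.2)⟩) (fun x _ => ⟨x.2.1, x.2.2⟩)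
      ?_ ?_ ?_ ?_ ?_
    · rintro ⟨a, b⟩ hx
      simp at hx ⊢
      omega
    · rintro ⟨s, a, b⟩ hx
      simp at hx ⊢
      omega
    · rintro ⟨a, b⟩ hx
      rfl
    · rintro ⟨s, a, b⟩ hx
      simp at hx
      obtain ⟨_, rfl⟩ := hx
      rfl
    · rintro ⟨a, b⟩ hx
      rfl
  · intro n hn
    rw [h1, Nat.sub_eq_zero_of_le hn]; simp

lemma tri (F : ℕ → ℕ → M) (p : ℕ) :
    ∑ k ∈ range (p + 1), ∑ n ∈ range (k + 1), F k n =
      ∑ a ∈ range (p + 1), ∑ n ∈ range (p - a + 1), F (a + n) n := by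
  rw [Finset.sum_sigma', Finset.sum_sigma']
  refine Finset.sum_bij' (fun x _ => ⟨x.1 - x.2, x.2⟩) (fun x _ => ⟨x.1 + x.2, x.2⟩)
      ?_ ?_ ?_ ?_ ?_
  · rintro ⟨a, b⟩ hx
    simp at hx ⊢
    omega
  · rintro ⟨a, b⟩ hx
    simp at hx ⊢
    omega
  · rintro ⟨a, b⟩ hx
    simp at hx ⊢
    omega
  · rintro ⟨a, b⟩ hx
    simp at hx ⊢
  · rintro ⟨a, b⟩ hx
    simp at hx ⊢
    rw [Nat.sub_add_cancel (by omega)]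

/-- Reindexing `k = q + s`. -/
lemma shiftsum (F : ℕ → M) (q K L : ℕ) (h : ∀ k, L ≤ k → F k = 0) (hK : L ≤ q + K) :
    ∑ s ∈ range K, F (q + s) = ∑ k ∈ range L, if q ≤ k then F k else 0 := by
  rw [← Finset.sum_filter]
  have : ∑ s ∈ range K, F (q + s) = ∑ k ∈ Ico q (q + K), F k := by
    rw [Finset.sum_Ico_eq_sum_range]; simp
  rw [this]
  symm
  apply Finset.sum_subset
  · intro k hk
    simp at hk ⊢
    omega
  · intro k hk hk'
    simp at hk hk'
    apply h
    by_contra hc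
    exact absurd (hk' (by omega)) (by omega)

end fin

lemma D_zero : DiffSuperAlg.D (0 : V) = 0 := by
  have := DiffSuperAlg.D_smul (V := V) 0 0
  simpa using this

lemma D_one : DiffSuperAlg.D (1 : V) = 0 := by
  have := DiffSuperAlg.D_mul (V := V) 1 1
  simpa using this

lemma Dp_coeff (P : Polynomial V) (n : ℕ) : (Dp P).coeff n = DiffSuperAlg.D (P.coeff n) := by
  unfold Dp
  rw [Polynomial.sum_def, Polynomial.finsetSum_coeff]
  simp only [Polynomial.coeff_C_mul_X_pow]
  rw [Finset.sum_ite_eq]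
  split_ifs with h
  · rfl
  · rw [Polynomial.notMem_support_iff.mp h, D_zero]

def DL : Module.End ℂ (Polynomial V) where
  toFun := Dp
  map_add' a b := by ext n; simp [Dp_coeff, DiffSuperAlg.D_add]
  map_smul' c a := by ext n; simp [Dp_coeff, DiffSuperAlg.D_smul]

def XL : Module.End ℂ (Polynomial V) := LinearMap.mulLeft ℂ (X : Polynomial V)

def E : Module.End ℂ (Polynomial V) := DL + XL

lemma DL_pow (n : ℕ) (P : Polynomial V) : (DL ^ n) P = DpIt n P := by
  rw [Module.End.pow_apply]; rfl

lemma XL_pow (n : ℕ) (P : Polynomial V) : (XL ^ n) P = X ^ n * P := by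
  induction n with
  | zero => simp
  | succ n ih =>
    rw [pow_succ', Module.End.mul_apply, ih, pow_succ', mul_assoc]
    rfl

lemma comm_DX : Commute (DL : Module.End ℂ (Polynomial V)) XL := by
  have hX : ∀ P : Polynomial V, XL P = X * P := fun P => rfl
  have hD : ∀ P : Polynomial V, DL P = Dp P := fun P => rfl
  refine LinearMap.ext fun P => ?_
  rw [Module.End.mul_apply, Module.End.mul_apply, hX, hX, hD, hD]
  ext n
  cases n with
  | zero => simp [Dp_coeff, D_zero]
  | succ n => simp [Dp_coeff, Polynomial.coeff_X_mul]

lemma E_pow (s : ℕ) (P : Polynomial V) :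
    (E ^ s) P = ∑ x ∈ antidiagonal s, (s.choose x.1 : ℂ) • (X ^ x.2 * DpIt x.1 P) := by
  unfold E
  rw [comm_DX.add_pow', LinearMap.sum_apply]
  apply Finset.sum_congr rfl
  intro x _
  rw [(comm_DX.pow_pow x.1 x.2).eq]
  simp only [LinearMap.smul_apply, Module.End.mul_apply, XL_pow, DL_pow]
  rw [Nat.cast_smul_eq_nsmul]

lemma E_pow_range (s : ℕ) (P : Polynomial V) :
    (E ^ s) P = ∑ m ∈ range (s + 1), (s.choose m : ℂ) • (X ^ (s - m) * DpIt m P) := by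
  rw [E_pow, Finset.Nat.sum_antidiagonal_eq_sum_range_succ_mk]

lemma DpIt_zero (n : ℕ) : DpIt n (0 : Polynomial V) = 0 := by
  rw [← DL_pow, map_zero]

lemma DpIt_C (n : ℕ) (a : V) : DpIt n (C a) = C (Dit n a) := by
  induction n with
  | zero => rfl
  | succ n ih =>
    have h1 : DpIt (n + 1) (C a) = Dp (DpIt n (C a)) := Function.iterate_succ_apply' _ _ _
    have h2 : Dit (n + 1) a = DiffSuperAlg.D (Dit n a) := Function.iterate_succ_apply' _ _ _
    rw [h1, h2, ih]
    ext m
    rw [Dp_coeff, Polynomial.coeff_C, Polynomial.coeff_C]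
    split_ifs <;> simp [D_zero]

lemma Dit_zero (n : ℕ) : Dit n (0 : V) = 0 := by
  have := DpIt_C n (0 : V)
  rw [map_zero, DpIt_zero] at this
  exact (Polynomial.C_eq_zero.mp this.symm)

lemma DL_X_pow (n : ℕ) : Dp (X ^ n : Polynomial V) = 0 := by
  ext m
  rw [Dp_coeff, Polynomial.coeff_X_pow]
  split_ifs <;> simp [D_zero, D_one]

lemma cc_mul (a : ℤ) (r n : ℕ) :
    cchoose a r * cchoose (a - r) n = cchoose a (r + n) * ((r + n).choose r : ℂ) := by
  unfold cchoose
  rw [Finset.prod_range_add, Nat.choose_symm_add, Nat.add_choose]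
  rw [Nat.cast_div (Nat.factorial_mul_factorial_dvd_factorial_add r n)
    (by exact_mod_cast (mul_ne_zero (Nat.factorial_ne_zero r) (Nat.factorial_ne_zero n)))]
  have h1 : (r.factorial : ℂ) ≠ 0 := by exact_mod_cast Nat.factorial_ne_zero r
  have h2 : (n.factorial : ℂ) ≠ 0 := by exact_mod_cast Nat.factorial_ne_zero n
  have h3 : ((r + n).factorial : ℂ) ≠ 0 := by exact_mod_cast Nat.factorial_ne_zero _
  push_cast
  have : ∏ x ∈ range n, ((a : ℂ) - r - x) = ∏ x ∈ range n, ((a : ℂ) - (r + x)) := by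
    apply Finset.prod_congr rfl; intros; ring
  rw [this]
  field_simp

lemma cc_ring (a : ℤ) (n : ℕ) : cchoose a n = ((Ring.choose a n : ℤ) : ℂ) := by
  unfold cchoose
  have h2 : (n.factorial : ℂ) ≠ 0 := by exact_mod_cast Nat.factorial_ne_zero n
  rw [div_eq_iff h2]
  have := Ring.descPochhammer_eq_factorial_smul_choose a n
  have h3 := congrArg (Int.cast : ℤ → ℂ) this
  rw [nsmul_eq_mul] at h3
  push_cast at h3
  rw [mul_comm, ← h3]
  rw [← Polynomial.eval_eq_smeval, descPochhammer_eval_eq_prod_range]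
  push_cast
  rfl

lemma cc_nat (a n : ℕ) : cchoose (a : ℤ) n = (a.choose n : ℂ) := by
  rw [cc_ring, Ring.choose_natCast]; simp

lemma cc_neg (i t : ℕ) : cchoose (-(i : ℤ) - 1) t = (-1) ^ t * ((t + i).choose i : ℂ) := by
  rw [cc_ring]
  have : (-(i : ℤ) - 1) = -((i + 1 : ℕ) : ℤ) := by push_cast; ring
  rw [this, Ring.choose_neg]
  have h2 : ((i + 1 : ℕ) : ℤ) + t - 1 = ((t + i : ℕ) : ℤ) := by push_cast; ring
  rw [h2, Ring.choose_natCast, Nat.choose_symm_add, Units.smul_def, Int.coe_negOnePow_natCast]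
  simp

lemma cc_vanish (a : ℤ) (n : ℕ) (h0 : 0 ≤ a) (h : a < n) : cchoose a n = 0 := by
  lift a to ℕ using h0
  rw [cc_nat, Nat.choose_eq_zero_of_lt (by omega)]; simp

lemma cc_vand (a b : ℤ) (n : ℕ) :
    cchoose (a + b) n = ∑ x ∈ antidiagonal n, cchoose a x.1 * cchoose b x.2 := by
  simp only [cc_ring]
  rw [Ring.add_choose_eq n (Commute.all a b)]
  push_cast; rfl

end PDO
namespace PDO

open Finset Polynomial

variable {V : Type*} [DiffSuperAlg V]

lemma pmulP_eq (F G : ℤ → Polynomial V) (m : ℤ) :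
    pmulP F G m = ∑ᶠ k : ℤ, ∑ᶠ n : ℕ, cchoose k n • (F k * DpIt n (G (m - k + n))) := by
  unfold pmulP
  apply finsum_congr
  intro k
  rw [← finsum_comp_equiv (Equiv.addLeft (m - k))]
  rw [fs_int_nat]
  · apply finsum_congr
    intro a
    rw [finsum_eq_single _ a]
    · rw [if_pos (by simp only [Equiv.coe_addLeft]; omega)]; rfl
    · intro n hn
      rw [if_neg]
      simp only [Equiv.coe_addLeft]
      omega
  · intro j hj
    apply finsum_eq_zero_of_forall_eq_zero
    intro n
    rw [if_neg]
    simp only [Equiv.coe_addLeft]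
    omega

lemma DpIt_one (n : ℕ) (hn : n ≠ 0) (P : Polynomial V) (hP : Dp P = 0) : DpIt n P = 0 := by
  obtain ⟨n, rfl⟩ := Nat.exists_eq_succ_of_ne_zero hn
  have h1 : DpIt (n + 1) P = DpIt n (Dp P) := Function.iterate_succ_apply _ _ _
  rw [h1, hP, DpIt_zero]

lemma cc_zero (k : ℤ) : cchoose k 0 = 1 := by simp [cchoose]

lemma pmulP_const (F G : ℤ → Polynomial V) (hG : ∀ k, Dp (G k) = 0) (m : ℤ) :
    pmulP F G m = ∑ᶠ k : ℤ, F k * G (m - k) := by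
  rw [pmulP_eq]
  apply finsum_congr
  intro k
  rw [finsum_eq_single _ 0]
  · rw [cc_zero, one_smul]
    simp [DpIt]
  · intro n hn
    rw [DpIt_one n hn _ (hG _)]; simp

lemma res_del (F : ℤ → Polynomial V) (j : ℤ) :
    resP (pmulP F (delP (-j - 1))) = F j := by
  unfold resP
  rw [pmulP_const]
  · rw [finsum_eq_single _ j]
    · simp only [delP]
      rw [if_pos (by ring), mul_one]
    · intro k hk
      simp only [delP]
      rw [if_neg (by omega)]; simp
  · intro k
    unfold delP
    split_ifs
    · simpa using DL_X_pow (V := V) 0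
    · exact DpIt_zero 1

/-- product of an operator `Σ a_p (∂+λ)^p` with `G`. -/
lemma shiftmul (F G : ℤ → Polynomial V) (a : ℕ → V) (K : ℕ)
    (hF0 : ∀ k : ℤ, k < 0 → F k = 0)
    (hF : ∀ k : ℕ, F k = ∑ p ∈ range K, (p.choose k : ℂ) • (X ^ (p - k) * C (a p))) (m : ℤ) :
    pmulP F G m = ∑ p ∈ range K, C (a p) *
      ∑ α ∈ range (p + 1), (p.choose α : ℂ) • (E ^ (p - α)) (G (m - α)) := by
  rw [pmulP_eq, fs_int _ K]
  · have h1 : ∀ k ∈ range K, ∑ᶠ n : ℕ, cchoose ((k : ℕ) : ℤ) n • (F (k : ℤ) * DpIt n (G (m - (k : ℤ) + n)))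
        = ∑ p ∈ range K, ∑ n ∈ range (k + 1), ((p.choose k : ℂ) * (k.choose n : ℂ)) •
          (C (a p) * (X ^ (p - k) * DpIt n (G (m - (k : ℤ) + n)))) := by
      intro k _
      rw [fs_nat _ (k + 1), Finset.sum_comm]
      · apply Finset.sum_congr rfl
        intro n _
        rw [hF, cc_nat, Finset.sum_mul, Finset.smul_sum]
        apply Finset.sum_congr rfl
        intro p _
        rw [smul_mul_assoc, smul_smul, mul_comm (k.choose n : ℂ), Polynomial.X_pow_mul, mul_assoc]
      · intro n hn
        rw [cc_nat, Nat.choose_eq_zero_of_lt (by omega)]; simp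
    rw [Finset.sum_congr rfl h1, Finset.sum_comm]
    apply Finset.sum_congr rfl
    intro p hp
    rw [mem_range] at hp
    rw [← Finset.sum_subset (s₁ := range (p + 1))]
    · rw [tri, Finset.mul_sum]
      apply Finset.sum_congr rfl
      intro α hα
      rw [mem_range] at hα
      rw [E_pow_range, Finset.smul_sum, Finset.mul_sum]
      apply Finset.sum_congr rfl
      intro n hn
      rw [mem_range] at hn
      rw [smul_smul, mul_smul_comm]
      congr 1
      · rw [← Nat.cast_mul, ← Nat.cast_mul, Nat.choose_symm_add.symm,
          Nat.choose_mul (by omega)]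
        simp
      · rw [Nat.sub_sub]
        have : m - ((α + n : ℕ) : ℤ) + n = m - α := by push_cast; ring
        rw [this]
    · intro x hx
      rw [mem_range] at *
      omega
    · intro k _ hk
      rw [mem_range] at hk
      apply Finset.sum_eq_zero
      intro n _
      rw [Nat.choose_eq_zero_of_lt (by omega)]; simp
  · intro k hk
    rw [hF0 k hk]; simp
  · intro k hk
    lift k to ℕ using (by omega)
    rw [hF, Finset.sum_eq_zero]
    · simp
    · intro p hp
      rw [mem_range] at hp
      rw [Nat.choose_eq_zero_of_lt (by omega)]; simp

lemma expW_eq (n : ℕ) (g : ℤ → V) (j : ℤ) :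
    expW n g j = ∑ α ∈ range (n + 1), (n.choose α : ℂ) • (E ^ (n - α)) (C (g (j - α))) := by
  unfold expW
  rw [fs_nat _ (n + 1)]
  · have : ∀ m ∈ range (n + 1), (∑ᶠ (α : ℕ), if m + α ≤ n then
        (((n.choose m) * ((n - m).choose α) : ℕ) : ℂ) •
      ((Polynomial.X : Polynomial V) ^ (n - m - α) * Polynomial.C (Dit m (g (j - (α : ℤ))))) else 0)
        = ∑ α ∈ range (n + 1), if m + α ≤ n then
        (((n.choose m) * ((n - m).choose α) : ℕ) : ℂ) •
      ((Polynomial.X : Polynomial V) ^ (n - m - α) * Polynomial.C (Dit m (g (j - (α : ℤ))))) else 0 := by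
      intro m _
      rw [fs_nat _ (n + 1)]
      intro α hα
      rw [if_neg (by omega)]
    rw [Finset.sum_congr rfl this, Finset.sum_comm]
    apply Finset.sum_congr rfl
    intro α hα
    rw [mem_range] at hα
    rw [E_pow_range, Finset.smul_sum]
    rw [← Finset.sum_subset (s₁ := range (n - α + 1))]
    · apply Finset.sum_congr rfl
      intro m hm
      rw [mem_range] at hm
      rw [if_pos (by omega), smul_smul, DpIt_C]
      congr 1
      · rw [← Nat.cast_mul]
        congr 1
        have h1 := Nat.choose_mul (n := n) (k := α + m) (s := m) (by omega)
        have h2 := Nat.choose_mul (n := n) (k := α + m) (s := α) (by omega)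
        rw [Nat.add_sub_cancel] at h1
        rw [Nat.add_sub_cancel_left] at h2
        rw [← h1, ← h2, Nat.choose_symm_add]
      · congr 2
        omega
    · intro x hx
      rw [mem_range] at *
      omega
    · intro m _ hm
      rw [mem_range] at hm
      rw [if_neg (by omega)]
  · intro m hm
    apply finsum_eq_zero_of_forall_eq_zero
    intro α
    rw [if_neg (by omega)]

lemma shiftLam_neg (f : ℤ → V) (N : ℕ) (hf : IsDiffOpLE f N) (k : ℤ) (hk : k < 0) :
    shiftLam f k = 0 := by
  unfold shiftLam
  apply finsum_eq_zero_of_forall_eq_zero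
  intro n
  by_cases h : k + n < 0
  · have : f (k + n) = 0 := by
      by_contra hc
      have := hf _ hc
      omega
    rw [this]; simp
  · rw [cc_vanish _ _ (by omega) (by omega)]; simp

lemma f_large {f : ℤ → V} {N : ℕ} (hf : IsDiffOpLE f N) (k : ℤ) (hk : k < 0 ∨ (N : ℤ) < k) :
    f k = 0 := by
  by_contra hc
  have := hf _ hc
  omega

lemma shiftLam_eq (f : ℤ → V) (N : ℕ) (hf : IsDiffOpLE f N) (k : ℕ) :
    shiftLam f k = ∑ p ∈ range (N + 1), (p.choose k : ℂ) • (X ^ (p - k) * C (f p)) := by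
  unfold shiftLam
  rw [fs_nat _ (N + 1)]
  · have := shiftsum (fun p => (p.choose k : ℂ) • (X ^ (p - k) * C (f p))) k (N + 1) (N + 1)
      (by intro p hp; rw [f_large hf _ (by omega)]; simp) (by omega)
    refine Eq.trans ?_ (this.trans ?_)
    · apply Finset.sum_congr rfl
      intro s _
      have h : ((k : ℤ) + s) = ((k + s : ℕ) : ℤ) := by push_cast; rfl
      rw [h, cc_nat, Nat.choose_symm_add, Nat.add_sub_cancel_left]
    · apply Finset.sum_congr rfl
      intro p _
      split_ifs with h
      · rfl
      · rw [Nat.choose_eq_zero_of_lt (by omega)]; simp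
  · intro n hn
    rw [f_large hf _ (by omega)]; simp

end PDO
namespace PDO

open Finset Polynomial

variable {V : Type*} [DiffSuperAlg V]

lemma adj_neg (g : ℤ → V) (N : ℕ) (hg : IsDiffOpLE g N) (m : ℤ) (hm : m < 0) : adj g m = 0 := by
  unfold adj
  apply finsum_eq_zero_of_forall_eq_zero
  intro n
  by_cases h : m + n < 0
  · rw [f_large hg _ (by omega), Dit_zero, smul_zero]
  · rw [cc_vanish _ _ (by omega) (by omega)]; simp

lemma adjSymb_neg (g : ℤ → V) (N : ℕ) (hg : IsDiffOpLE g N) (q : ℤ) (hq : q < 0) :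
    adjSymb g q = 0 := by
  unfold adjSymb
  apply finsum_eq_zero_of_forall_eq_zero
  intro b
  by_cases h : q + b < 0
  · rw [adj_neg g N hg _ h]; simp
  · rw [cc_vanish _ _ (by omega) (by omega)]; simp

lemma adjSymb_eq (g : ℤ → V) (N : ℕ) (hg : IsDiffOpLE g N) (q : ℕ) :
    adjSymb g q = ∑ k ∈ range (N + 1), ((-1 : ℂ) ^ (k + q) * (k.choose q : ℂ)) •
      (E ^ (k - q)) (C (g k)) := by
  unfold adjSymb
  have h1 : ∀ b : ℕ, ((-1 : ℂ) ^ (q : ℤ) * cchoose ((q : ℤ) + b) b) •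
      ((X : Polynomial V) ^ b * C (adj g ((q : ℤ) + b))) =
      ∑ᶠ n : ℕ, ((-1 : ℂ) ^ (b + n) * (cchoose ((q + (b + n) : ℕ) : ℤ) (n + b) * ((n + b).choose n : ℂ))) •
        ((X : Polynomial V) ^ b * C (Dit n (g ((q + (b + n) : ℕ) : ℤ)))) := by
    intro b
    have hz : ∀ n, N + 1 ≤ n → g ((q : ℤ) + b + n) = 0 := fun n hn => f_large hg _ (by omega)
    have e : ∀ n : ℕ, ((q + (b + n) : ℕ) : ℤ) = (q : ℤ) + b + n := by intro n; push_cast; ring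
    unfold adj
    rw [fs_nat _ (N + 1), fs_nat _ (N + 1), map_sum, Finset.mul_sum, Finset.smul_sum]
    · apply Finset.sum_congr rfl
      intro n _
      rw [← Polynomial.smul_C, mul_smul_comm, smul_smul, e, ← cc_mul]
      congr 1
      have e2 : (q : ℤ) + b + n - n = q + b := by ring
      rw [e2, ← e, zpow_natCast, zpow_natCast]
      have : (-1 : ℂ) ^ q * (-1) ^ (q + (b + n)) = (-1) ^ (b + n) := by
        rw [← pow_add, show q + (q + (b + n)) = 2 * q + (b + n) by ring, pow_add, pow_mul]; simp
      rw [← this]; ring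
    · intro n hn
      rw [e, hz n hn, Dit_zero]; simp
    · intro n hn
      rw [hz n hn, Dit_zero]; simp
  rw [finsum_congr h1, dbl _ (N + 1)]
  · have := shiftsum (fun k => ((-1 : ℂ) ^ (k + q) * (k.choose q : ℂ)) • (E ^ (k - q)) (C (g k)))
      q (N + 1) (N + 1)
      (by intro p hp; rw [f_large hg _ (by omega)]; simp) (by omega)
    refine Eq.trans ?_ (this.trans ?_)
    · apply Finset.sum_congr rfl
      intro s _
      rw [Nat.add_sub_cancel_left, E_pow, Finset.smul_sum, ← Finset.Nat.sum_antidiagonal_swap]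
      apply Finset.sum_congr rfl
      rintro ⟨n, b⟩ hx
      rw [HasAntidiagonal.mem_antidiagonal] at hx
      simp only at hx
      subst hx
      simp only [Prod.fst_swap, Prod.snd_swap]
      rw [smul_smul, DpIt_C, add_comm b n, cc_nat]
      congr 1
      have : (-1 : ℂ) ^ (q + (n + b) + q) = (-1) ^ (n + b) := by
        rw [show q + (n + b) + q = 2 * q + (n + b) by ring, pow_add, pow_mul]; simp
      rw [this, mul_assoc,
        (Nat.choose_symm_add : (q + (n + b)).choose q = (q + (n + b)).choose (n + b))]
    · apply Finset.sum_congr rfl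
      intro p _
      split_ifs with h
      · rfl
      · rw [Nat.choose_eq_zero_of_lt (by omega)]; simp
  · intro b n hbn
    rw [f_large hg _ (by omega), Dit_zero]; simp

lemma appW_eq (f : ℤ → V) (P : Polynomial V) (N : ℕ) (hf : IsDiffOpLE f N) (j n : ℕ) :
    appW (fun k => f (k - n)) P j = ∑ p ∈ range (N + 1), ((p + n).choose j : ℂ) •
      (C (f p) * (E ^ (p + n - j)) P) := by
  unfold appW
  have h0 : ∀ b c : ℕ, (cchoose ((j : ℤ) + b + c) b * cchoose ((j : ℤ) + c) c) •
      ((X : Polynomial V) ^ c * (C (f ((j : ℤ) + b + c - n)) * DpIt b P)) =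
      (cchoose (((j + (b + c) : ℕ)) : ℤ) (b + c) * ((b + c).choose b : ℂ)) •
      (C (f (((j + (b + c) : ℕ) : ℤ) - n)) * ((X : Polynomial V) ^ c * DpIt b P)) := by
    intro b c
    have e : ((j + (b + c) : ℕ) : ℤ) = (j : ℤ) + b + c := by push_cast; ring
    rw [← cc_mul, e, show (j : ℤ) + b + c - b = j + c by ring, ← mul_assoc, ← mul_assoc,
      Polynomial.X_pow_mul]
  simp only [h0]
  rw [dbl _ (N + n + 1)]
  · have := shiftsum (fun k => ((k.choose j : ℂ)) • (C (f ((k : ℤ) - n)) * (E ^ (k - j)) P))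
      j (N + n + 1) (N + n + 1)
      (by intro p hp; rw [f_large hf _ (by omega)]; simp) (by omega)
    have h2 := shiftsum (fun k => ((k.choose j : ℂ)) • (C (f ((k : ℤ) - n)) * (E ^ (k - j)) P))
      n (N + 1) (N + n + 1)
      (by intro p hp; rw [f_large hf _ (by omega)]; simp) (by omega)
    refine Eq.trans ?_ (this.trans (Eq.trans ?_ (h2.symm.trans ?_)))
    · apply Finset.sum_congr rfl
      intro s _
      rw [Nat.add_sub_cancel_left, E_pow, Finset.mul_sum, Finset.smul_sum]
      apply Finset.sum_congr rfl
      rintro ⟨b, c⟩ hx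
      rw [HasAntidiagonal.mem_antidiagonal] at hx
      simp only at hx
      subst hx
      rw [mul_smul_comm, smul_smul, cc_nat, ← Nat.choose_symm_add]
    · apply Finset.sum_congr rfl
      intro p _
      by_cases h : j ≤ p
      · rw [if_pos h]
        split_ifs with h'
        · rfl
        · rw [f_large hf _ (by omega)]; simp
      · rw [if_neg h, Nat.choose_eq_zero_of_lt (by omega)]; simp
    · apply Finset.sum_congr rfl
      intro p _
      simp only [add_comm n p]
      congr 4
      push_cast; ring
  · intro a b hab
    rw [f_large hf _ (by omega)]; simp

lemma appW_neg (f : ℤ → V) (P : Polynomial V) (N : ℕ) (hf : IsDiffOpLE f N) (j : ℤ) (hj : j < 0)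
    (n : ℕ) : appW (fun k => f (k - n)) P j = 0 := by
  unfold appW
  apply finsum_eq_zero_of_forall_eq_zero
  intro a
  apply finsum_eq_zero_of_forall_eq_zero
  intro b
  by_cases h : j + b < 0
  · by_cases h' : j + a + b < 0
    · simp only [f_large hf (j + a + b - n) (by omega)]; simp
    · rw [cc_vanish (j + a + b) _ (by omega) (by omega)]; simp
  · rw [cc_vanish (j + b) _ (by omega) (by omega)]; simp

/-- basic building block -/
def Mb (f g : ℤ → V) (p k e : ℕ) : Polynomial V := C (f p) * (E ^ e) (C (g k))

def sa (N : ℕ) (i : ℤ) (j p k : ℕ) : ℂ :=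
  ∑ q ∈ range (N + 1), if i + 1 ≤ (q : ℤ) then
    ((p + ((q : ℤ) - i - 1).toNat).choose j : ℂ) * ((-1 : ℂ) ^ (k + q) * (k.choose q : ℂ)) else 0

def sb (i : ℤ) (j p k : ℕ) : ℂ :=
  if i < p ∧ k ≤ j then ((((p : ℤ) - 1 - i).toNat).choose (j - k) : ℂ) else 0

lemma iotaA_eq (f g : ℤ → V) (N : ℕ) (hf : IsDiffOpLE f N) (hg : IsDiffOpLE g N) (i : ℤ) (j : ℕ) :
    iotaTermA f g i j = ∑ p ∈ range (N + 1), ∑ k ∈ range (N + 1),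
      sa N i j p k • Mb f g p k ((p : ℤ) + k - 1 - i - j).toNat := by
  unfold iotaTermA
  have h1 : ∑ᶠ n : ℕ, appW (fun k => f (k - n)) (adjSymb g (i + n + 1)) j =
      ∑ q ∈ range (N + 1), if i + 1 ≤ (q : ℤ) then
        appW (fun k => f (k - (((q : ℤ) - i - 1).toNat : ℕ))) (adjSymb g q) j else 0 := by
    have e1 : ∑ᶠ q : ℤ, (if i + 1 ≤ (q : ℤ) then
        appW (fun k => f (k - (((q : ℤ) - i - 1).toNat : ℕ))) (adjSymb g q) j else 0) =
        ∑ᶠ n : ℕ, appW (fun k => f (k - n)) (adjSymb g (i + n + 1)) j := by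
      rw [fs_shift _ (i + 1), fs_int_nat]
      · apply finsum_congr
        intro n
        rw [if_pos (by omega)]
        have e2 : (i + 1 + (n : ℤ) - i - 1).toNat = n := by omega
        rw [e2, show i + 1 + (n : ℤ) = i + n + 1 by ring]
      · intro k hk
        rw [if_neg (by omega)]
    rw [← e1, fs_int _ (N + 1)]
    · intro q hq
      rw [adjSymb_neg g N hg q hq, appW_eq f _ N hf]
      simp
    · intro q hq
      lift q to ℕ using (by omega)
      have : adjSymb g q = 0 := by
        rw [adjSymb_eq g N hg]
        apply Finset.sum_eq_zero
        intro k hk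
        rw [mem_range] at hk
        rw [Nat.choose_eq_zero_of_lt (by omega)]; simp
      rw [this, appW_eq f _ N hf]
      simp
  rw [h1]
  simp only [sa, Finset.sum_smul]
  rw [show (∑ p ∈ range (N + 1), ∑ k ∈ range (N + 1), ∑ q ∈ range (N + 1),
      (if i + 1 ≤ (q : ℤ) then
    ((p + ((q : ℤ) - i - 1).toNat).choose j : ℂ) * ((-1 : ℂ) ^ (k + q) * (k.choose q : ℂ)) else 0) •
      Mb f g p k ((p : ℤ) + k - 1 - i - j).toNat) =
      ∑ q ∈ range (N + 1), ∑ p ∈ range (N + 1), ∑ k ∈ range (N + 1),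
      (if i + 1 ≤ (q : ℤ) then
    ((p + ((q : ℤ) - i - 1).toNat).choose j : ℂ) * ((-1 : ℂ) ^ (k + q) * (k.choose q : ℂ)) else 0) •
      Mb f g p k ((p : ℤ) + k - 1 - i - j).toNat by
        rw [Finset.sum_comm]
        refine (Finset.sum_congr rfl fun k _ => Finset.sum_comm).trans ?_
        rw [Finset.sum_comm]
        exact Finset.sum_congr rfl fun k _ => Finset.sum_comm]
  apply Finset.sum_congr rfl
  intro q _
  split_ifs with h
  · rw [appW_eq f _ N hf]
    apply Finset.sum_congr rfl
    intro p _
    rw [adjSymb_eq g N hg, map_sum, Finset.mul_sum, Finset.smul_sum]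
    apply Finset.sum_congr rfl
    intro k _
    rw [map_smul, mul_smul_comm, smul_smul, ← Module.End.mul_apply, ← pow_add]
    by_cases hq : q ≤ k
    · by_cases hj : j ≤ p + ((q : ℤ) - i - 1).toNat
      · unfold Mb
        congr 4
        omega
      · rw [Nat.choose_eq_zero_of_lt (n := p + _) (by omega)]; simp
    · rw [Nat.choose_eq_zero_of_lt (show k < q by omega)]; simp
  · simp

lemma iotaB_pre (f g : ℤ → V) (N : ℕ) (hf : IsDiffOpLE f N) (i j : ℤ) :
    iotaTermB f g i j = ∑ p ∈ range (N + 1), if i < p then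
      C (f p) * expW ((p : ℤ) - 1 - i).toNat g j else 0 := by
  unfold iotaTermB
  have e1 : ∑ᶠ p : ℤ, (if i < p then
      C (f p) * expW ((p : ℤ) - 1 - i).toNat g j else 0) =
      ∑ᶠ n : ℕ, C (f (i + n + 1)) * expW n g j := by
    rw [fs_shift _ (i + 1), fs_int_nat]
    · apply finsum_congr
      intro n
      rw [if_pos (by omega)]
      have e2 : (i + 1 + (n : ℤ) - 1 - i).toNat = n := by omega
      rw [e2, show i + 1 + (n : ℤ) = i + n + 1 by ring]
    · intro k hk
      rw [if_neg (by omega)]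
  rw [← e1, fs_int _ (N + 1)]
  · intro q hq
    rw [f_large hf q (by omega)]; simp
  · intro q hq
    rw [f_large hf q (by omega)]; simp

lemma expW_eq' (n : ℕ) (g : ℤ → V) (N : ℕ) (hg : IsDiffOpLE g N) (j : ℕ) :
    expW n g j = ∑ k ∈ range (N + 1), (if k ≤ j then (n.choose (j - k) : ℂ) else 0) •
      (E ^ (n - (j - k))) (C (g k)) := by
  rw [expW_eq]
  have h1 : ∑ α ∈ range (n + 1), (n.choose α : ℂ) • (E ^ (n - α)) (C (g ((j : ℤ) - α))) =
      ∑ α ∈ range (j + 1), (n.choose α : ℂ) • (E ^ (n - α)) (C (g ((j : ℤ) - α))) := by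
    rw [← fs_nat _ (n + 1), ← fs_nat _ (j + 1)]
    · intro α h
      rw [f_large hg _ (by omega)]; simp
    · intro α h
      rw [Nat.choose_eq_zero_of_lt (by omega)]; simp
  rw [h1, ← Finset.sum_range_reflect]
  have : ∀ k : ℕ, ((if k ≤ j then (n.choose (j - k) : ℂ) else 0) •
      (E ^ (n - (j - k))) (C (g k)) : Polynomial V) =
      if k ≤ j then (n.choose (j - k) : ℂ) • (E ^ (n - (j - k))) (C (g k)) else 0 := by
    intro k; split_ifs <;> simp
  simp only [this]
  rw [← fs_nat (fun k : ℕ => if k ≤ j then (n.choose (j - k) : ℂ) • (E ^ (n - (j - k))) (C (g k)) else 0)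
    (N + 1), fs_nat _ (j + 1)]
  · apply Finset.sum_congr rfl
    intro k hk
    rw [mem_range] at hk
    rw [if_pos (by omega), show j + 1 - 1 - k = j - k by omega,
      show (j : ℤ) - ((j - k : ℕ) : ℤ) = k by omega]
  · intro k hk
    rw [if_neg (by omega)]
  · intro k hk
    rw [f_large hg _ (by omega)]; simp

lemma iotaB_eq (f g : ℤ → V) (N : ℕ) (hf : IsDiffOpLE f N) (hg : IsDiffOpLE g N) (i : ℤ) (j : ℕ) :
    iotaTermB f g i j = ∑ p ∈ range (N + 1), ∑ k ∈ range (N + 1),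
      sb i j p k • Mb f g p k ((p : ℤ) + k - 1 - i - j).toNat := by
  rw [iotaB_pre f g N hf]
  apply Finset.sum_congr rfl
  intro p _
  split_ifs with h
  · rw [expW_eq' _ g N hg, Finset.mul_sum]
    apply Finset.sum_congr rfl
    intro k _
    rw [mul_smul_comm]
    unfold sb Mb
    by_cases hk : k ≤ j
    · rw [if_pos hk, if_pos ⟨h, hk⟩]
      by_cases h2 : j - k ≤ ((p : ℤ) - 1 - i).toNat
      · congr 4
        omega
      · rw [Nat.choose_eq_zero_of_lt (by omega)]; simp
    · rw [if_neg hk, if_neg (by tauto)]; simp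
  · symm
    apply Finset.sum_eq_zero
    intro k _
    unfold sb
    rw [if_neg (by tauto)]; simp

end PDO
namespace PDO

open Finset Polynomial

lemma sc1 (p m i K : ℕ) (hp : p < K) :
    (∑ k ∈ range K, if m + i + 1 ≤ k then
      (p.choose k : ℂ) * cchoose (-(i : ℤ) - 1) (k - (m + i + 1)) else 0) =
    if m + i + 1 ≤ p then ((p - i - 1).choose m : ℂ) else 0 := by
  have h0 : (∑ k ∈ range K, if m + i + 1 ≤ k then
      (p.choose k : ℂ) * cchoose (-(i : ℤ) - 1) (k - (m + i + 1)) else 0) =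
      ∑ k ∈ range (p + 1), if m + i + 1 ≤ k then
      (p.choose k : ℂ) * cchoose (-(i : ℤ) - 1) (k - (m + i + 1)) else 0 := by
    symm
    apply Finset.sum_subset
    · intro x hx
      rw [mem_range] at *
      omega
    · intro k _ hk
      rw [mem_range] at hk
      rw [Nat.choose_eq_zero_of_lt (by omega)]; simp
  rw [h0]
  split_ifs with h
  · obtain ⟨t, rfl⟩ := Nat.exists_eq_add_of_le h
    rw [← shiftsum (fun k => ((m + i + 1 + t).choose k : ℂ) * cchoose (-(i : ℤ) - 1) (k - (m + i + 1)))
      (m + i + 1) (t + 1) (m + i + 1 + t + 1)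
      (by intro k hk; rw [Nat.choose_eq_zero_of_lt (by omega)]; simp) (by omega)]
    have e1 : m + i + 1 + t - i - 1 = m + t := by omega
    rw [e1, Nat.choose_symm_add, ← cc_nat]
    have e2 : ((m + t : ℕ) : ℤ) = ((m + i + 1 + t : ℕ) : ℤ) + (-(i : ℤ) - 1) := by push_cast; ring
    rw [e2, cc_vand, ← Finset.Nat.sum_antidiagonal_swap,
      Finset.Nat.sum_antidiagonal_eq_sum_range_succ_mk]
    apply Finset.sum_congr rfl
    intro s hs
    rw [mem_range] at hs
    simp only [Prod.fst_swap, Prod.snd_swap]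
    rw [Nat.add_sub_cancel_left, cc_nat, ← Nat.choose_symm (n := m + i + 1 + t) (k := t - s) (by omega)]
    congr 3
    omega
  · apply Finset.sum_eq_zero
    intro k hk
    rw [mem_range] at hk
    rw [if_neg (by omega)]

lemma scS (i : ℕ) (k : ℕ) : ∀ m K : ℕ, k ≤ K →
    ∑ n ∈ range K, (n.choose m : ℂ) * ((-1 : ℂ) ^ (k + (i + 1 + n)) * (k.choose (i + 1 + n) : ℂ)) =
    if m + i + 1 ≤ k then (-1 : ℂ) ^ (k - (m + i + 1)) * ((k - (m + i + 1) + i).choose i : ℂ)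
      else 0 := by
  induction k with
  | zero =>
    intro m K _
    rw [if_neg (by omega)]
    apply Finset.sum_eq_zero
    intro n _
    rw [Nat.choose_eq_zero_of_lt (n := 0) (by omega)]; simp
  | succ k ih =>
    intro m K hK
    let h : ℕ → ℂ := fun n => (-1 : ℂ) ^ (k + (i + n)) * (k.choose (i + n) : ℂ)
    have h1 : ∑ n ∈ range K, (n.choose m : ℂ) *
        ((-1 : ℂ) ^ (k + 1 + (i + 1 + n)) * ((k + 1).choose (i + 1 + n) : ℂ)) =
        ∑ n ∈ range K, (n.choose m : ℂ) * h n - ∑ n ∈ range K, (n.choose m : ℂ) * h (n + 1) := by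
      rw [← Finset.sum_sub_distrib]
      apply Finset.sum_congr rfl
      intro n _
      simp only [h]
      rw [show i + 1 + n = (i + n) + 1 by ring, Nat.choose_succ_succ]
      push_cast
      rw [show i + (n + 1) = i + n + 1 by ring]
      ring
    have h2 : ∑ n ∈ range K, (n.choose m : ℂ) * h n =
        ∑ n ∈ range K, ((n + 1).choose m : ℂ) * h (n + 1) + (Nat.choose 0 m : ℂ) * h 0 := by
      rw [← Finset.sum_range_succ' (fun n => (n.choose m : ℂ) * h n), Finset.sum_range_succ]
      have : h K = 0 := by
        simp only [h]
        rw [Nat.choose_eq_zero_of_lt (by omega)]; simp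
      rw [this]; simp
    rw [h1, h2]
    cases m with
    | zero =>
      simp only [Nat.choose_zero_right, Nat.cast_one, one_mul, h]
      rw [add_sub_cancel_left]
      by_cases hk : i ≤ k
      · obtain ⟨t, rfl⟩ := Nat.exists_eq_add_of_le hk
        rw [if_pos (by omega), show i + t + 1 - (0 + i + 1) = t by omega]
        rw [show i + t + (i + 0) = 2 * i + t by ring, pow_add, pow_mul, add_comm t i]
        simp
      · rw [if_neg (by omega), Nat.choose_eq_zero_of_lt (by omega)]; simp
    | succ m =>
      have h3 := ih m K (by omega)
      have h4 : ∑ n ∈ range K, ((n + 1).choose (m + 1) : ℂ) * h (n + 1) -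
          ∑ n ∈ range K, (n.choose (m + 1) : ℂ) * h (n + 1) =
          ∑ n ∈ range K, (n.choose m : ℂ) *
            ((-1 : ℂ) ^ (k + (i + 1 + n)) * (k.choose (i + 1 + n) : ℂ)) := by
        rw [← Finset.sum_sub_distrib]
        apply Finset.sum_congr rfl
        intro n _
        simp only [h]
        rw [Nat.choose_succ_succ n m, show i + 1 + n = i + (n + 1) by ring]
        push_cast
        ring
      have h5 : ((Nat.choose 0 (m + 1) : ℕ) : ℂ) = 0 := by simp
      rw [h5, zero_mul, add_zero, h4, h3]
      rw [show k + 1 - (m + 1 + i + 1) = k - (m + i + 1) by omega]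
      simp only [show (m + 1 + i + 1 ≤ k + 1) = (m + i + 1 ≤ k) by apply propext; omega]

def sr (i j p k : ℕ) : ℂ :=
  ∑ α ∈ range (p + 1), if α ≤ j ∧ j - α + i + 1 ≤ k then
    (p.choose α : ℂ) * cchoose (-(i : ℤ) - 1) (k - (j - α + i + 1)) else 0

lemma sc2 (N i j p k : ℕ) (hk : k ≤ N) : sa N i j p k = sr i j p k := by
  have h1 : sa N i j p k = ∑ n ∈ range (N + 1), ((p + n).choose j : ℂ) *
      ((-1 : ℂ) ^ (k + (i + 1 + n)) * (k.choose (i + 1 + n) : ℂ)) := by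
    have := shiftsum (fun q => ((p + (q - i - 1)).choose j : ℂ) *
      ((-1 : ℂ) ^ (k + q) * (k.choose q : ℂ))) (i + 1) (N + 1) (N + 1)
      (by intro q hq; rw [Nat.choose_eq_zero_of_lt (n := k) (by omega)]; simp) (by omega)
    unfold sa
    refine Eq.trans ?_ (this.symm.trans ?_)
    · apply Finset.sum_congr rfl
      intro q _
      by_cases h : i + 1 ≤ q
      · rw [if_pos h, if_pos (by omega)]
        congr 4
        omega
      · rw [if_neg h, if_neg (by omega)]
    · apply Finset.sum_congr rfl
      intro n _
      rw [show i + 1 + n - i - 1 = n by omega]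
  have h2 : sa N i j p k = ∑ α ∈ range (j + 1), (p.choose α : ℂ) *
      ∑ n ∈ range (N + 1), (n.choose (j - α) : ℂ) *
      ((-1 : ℂ) ^ (k + (i + 1 + n)) * (k.choose (i + 1 + n) : ℂ)) := by
    rw [h1]
    simp only [Finset.mul_sum]
    rw [Finset.sum_comm]
    apply Finset.sum_congr rfl
    intro n _
    rw [Nat.add_choose_eq, Finset.Nat.sum_antidiagonal_eq_sum_range_succ_mk]
    push_cast
    rw [Finset.sum_mul]
    apply Finset.sum_congr rfl
    intro α _
    ring
  rw [h2]
  unfold sr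
  rw [← fs_nat _ (p + 1), fs_nat _ (j + 1)]
  · apply Finset.sum_congr rfl
    intro α hα
    rw [mem_range] at hα
    rw [scS i k _ _ (by omega), cc_neg]
    by_cases h : j - α + i + 1 ≤ k
    · rw [if_pos h, if_pos ⟨by omega, h⟩]
    · rw [if_neg h, if_neg (by tauto)]; simp
  · intro α hα
    rw [if_neg (by omega)]
  · intro α hα
    rw [Nat.choose_eq_zero_of_lt (by omega)]; simp

lemma sc3 (e j k N : ℕ) (hk : k ≤ N) :
    (if k ≤ j then (e.choose (j - k) : ℂ) else 0) =
    ∑ q ∈ range (N + 1), ((e + q).choose j : ℂ) * ((-1 : ℂ) ^ (k + q) * (k.choose q : ℂ)) := by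
  have h1 : ((1 + X : Polynomial ℂ) ^ e * X ^ k) =
      ∑ q ∈ range (N + 1), C ((-1 : ℂ) ^ (k + q) * (k.choose q : ℂ)) * (1 + X) ^ (e + q) := by
    have hX : (X : Polynomial ℂ) ^ k = ((1 + X) + (-1)) ^ k := by ring
    rw [hX, add_pow (1 + Polynomial.X : Polynomial ℂ) (-1) k, Finset.mul_sum]
    rw [← Finset.sum_subset (s₁ := range (k + 1)) (s₂ := range (N + 1))]
    · apply Finset.sum_congr rfl
      intro q hq
      rw [mem_range] at hq
      obtain ⟨t, rfl⟩ := Nat.exists_eq_add_of_le (show q ≤ k by omega)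
      rw [show q + t + q = 2 * q + t by ring, Nat.add_sub_cancel_left, pow_add (-1 : ℂ), pow_mul]
      simp
      ring
    · intro x hx
      rw [mem_range] at *
      omega
    · intro q _ hq
      rw [mem_range] at hq
      rw [Nat.choose_eq_zero_of_lt (by omega)]; simp
  have h2 := congrArg (fun P => Polynomial.coeff P j) h1
  simp only [Polynomial.coeff_mul_X_pow', Polynomial.finsetSum_coeff, Polynomial.coeff_C_mul,
    Polynomial.coeff_one_add_X_pow] at h2
  rw [h2]
  apply Finset.sum_congr rfl
  intro q _
  ring

lemma sc4 (N : ℕ) (i : ℤ) (j p k : ℕ) (hp : p ≤ N) (hk : k ≤ N)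
    (h : i < 0 ∨ (N : ℤ) ≤ i ∨ N ≤ j) : sb i j p k = sa N i j p k := by
  unfold sb sa
  by_cases hi : i < p
  · have : (if i < (p : ℤ) ∧ k ≤ j then ((((p : ℤ) - 1 - i).toNat).choose (j - k) : ℂ) else 0) =
        if k ≤ j then ((((p : ℤ) - 1 - i).toNat).choose (j - k) : ℂ) else 0 := by simp [hi]
    rw [this, sc3 _ j k N hk]
    apply Finset.sum_congr rfl
    intro q _
    split_ifs with h'
    · congr 3
      omega
    · rw [Nat.choose_eq_zero_of_lt (n := _ + q) (by omega)]; simp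
  · rw [if_neg (by tauto)]
    symm
    apply Finset.sum_eq_zero
    intro q hq
    rw [mem_range] at hq
    split_ifs with h'
    · by_cases hqk : k < q
      · rw [Nat.choose_eq_zero_of_lt hqk]; simp
      · rw [Nat.choose_eq_zero_of_lt (n := p + _) (by omega)]; simp
    · rfl

variable {V : Type*} [DiffSuperAlg V]

lemma Dp_powLam (e m : ℤ) : Dp (powLam e m : Polynomial V) = 0 := by
  unfold powLam
  split_ifs
  · exact (map_smul (DL (V := V)) _ _).trans (by rw [show DL (X ^ (e - m).toNat : Polynomial V) = 0 from DL_X_pow _, smul_zero])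
  · exact DpIt_zero 1

lemma R1_inner (f : ℤ → V) (N : ℕ) (hf : IsDiffOpLE f N) (i m : ℕ) :
    pmulP (shiftLam f) (powLam (-(i : ℤ) - 1)) (m : ℤ) =
      ∑ p ∈ range (N + 1), (p.choose m : ℂ) • (X ^ (p - m) * C (f ((i + 1 + p : ℕ) : ℤ))) := by
  rw [pmulP_const _ _ (Dp_powLam _), fs_int _ (N + 1)]
  · have h1 : ∀ k ∈ range (N + 1), shiftLam f k * powLam (-(i : ℤ) - 1) ((m : ℤ) - k) =
        ∑ p ∈ range (N + 1), (if m + i + 1 ≤ k then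
          (p.choose k : ℂ) * cchoose (-(i : ℤ) - 1) (k - (m + i + 1)) else 0) •
          (X ^ (p - i - 1 - m) * C (f p)) := by
      intro k _
      rw [shiftLam_eq f N hf, Finset.sum_mul]
      apply Finset.sum_congr rfl
      intro p _
      unfold powLam
      by_cases hk : m + i + 1 ≤ k
      · rw [if_pos hk, if_pos (by omega)]
        by_cases hp : k ≤ p
        · have e1 : (-(i : ℤ) - 1 - ((m : ℤ) - k)).toNat = k - (m + i + 1) := by omega
          rw [e1, smul_mul_smul_comm, mul_assoc, ← Polynomial.X_pow_mul, ← mul_assoc, ← pow_add]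
          congr 3
          omega
        · rw [Nat.choose_eq_zero_of_lt (by omega)]; simp
      · rw [if_neg hk, if_neg (by omega)]; simp
    rw [Finset.sum_congr rfl h1, Finset.sum_comm]
    simp only [← Finset.sum_smul]
    have := shiftsum (fun p => ((p - i - 1).choose m : ℂ) • (X ^ (p - i - 1 - m) * C (f p)))
      (i + 1) (N + 1) (N + 1)
      (by intro p hp; rw [f_large hf _ (by omega)]; simp) (by omega)
    refine Eq.trans ?_ (this.symm.trans ?_)
    · apply Finset.sum_congr rfl
      intro p hp
      rw [mem_range] at hp
      rw [sc1 p m i _ hp]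
      by_cases h : m + i + 1 ≤ p
      · rw [if_pos h, if_pos (by omega)]
      · rw [if_neg h]
        split_ifs
        · rw [Nat.choose_eq_zero_of_lt (by omega)]; simp
        · simp
    · apply Finset.sum_congr rfl
      intro p _
      rw [show i + 1 + p - i - 1 = p by omega]
  · intro k hk
    rw [shiftLam_neg f N hf k hk, zero_mul]
  · intro k hk
    lift k to ℕ using (by omega)
    rw [shiftLam_eq f N hf, Finset.sum_eq_zero, zero_mul]
    intro p hp
    rw [mem_range] at hp
    rw [Nat.choose_eq_zero_of_lt (by omega)]; simp

lemma R1_eq (f g : ℤ → V) (N : ℕ) (hf : IsDiffOpLE f N) (i : ℕ) (j : ℤ) :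
    pmulP (dplusP (pmulP (shiftLam f) (powLam (-(i : ℤ) - 1)))) (constP g) j =
      iotaTermB f g i j := by
  rw [shiftmul _ _ (fun p => f ((i + 1 + p : ℕ) : ℤ)) (N + 1)]
  · unfold iotaTermB
    rw [fs_nat _ (N + 1)]
    · apply Finset.sum_congr rfl
      intro p _
      rw [expW_eq]
      have : ((i + 1 + p : ℕ) : ℤ) = (i : ℤ) + p + 1 := by push_cast; ring
      rw [this]
      rfl
    · intro n hn
      rw [f_large hf _ (by omega)]; simp
  · intro k hk
    unfold dplusP
    rw [if_neg (by omega)]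
  · intro k
    unfold dplusP
    rw [if_pos (by omega), R1_inner f N hf]

lemma R2_inner (g : ℤ → V) (N : ℕ) (hg : IsDiffOpLE g N) (i m : ℕ) :
    pmulP (powLam (-(i : ℤ) - 1)) (constP g) (m : ℤ) =
      ∑ k ∈ range (N + 1), (if m + i + 1 ≤ k then cchoose (-(i : ℤ) - 1) (k - (m + i + 1)) else 0) •
        (E ^ (k - (m + i + 1))) (C (g k)) := by
  rw [pmulP_eq]
  rw [← finsum_comp_equiv (Equiv.subLeft (-(i : ℤ) - 1))]
  simp only [Equiv.subLeft_apply]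
  rw [fs_int_nat]
  · have h1 : ∀ r n : ℕ, cchoose (-(i : ℤ) - 1 - r) n • (powLam (-(i : ℤ) - 1) (-(i : ℤ) - 1 - r) *
        DpIt n (constP g ((m : ℤ) - (-(i : ℤ) - 1 - r) + n))) =
        (cchoose (-(i : ℤ) - 1) (r + n) * ((r + n).choose r : ℂ)) •
          (X ^ r * DpIt n (C (g ((m + i + 1 + (r + n) : ℕ) : ℤ)))) := by
      intro r n
      unfold powLam constP
      rw [if_pos (by omega), show (-(i : ℤ) - 1 - (-(i : ℤ) - 1 - r)).toNat = r by omega,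
        ← cc_mul, smul_mul_assoc, smul_smul, mul_comm (cchoose (-(i : ℤ) - 1) r)]
      congr 5
      push_cast; ring_nf
    simp only [h1]
    rw [dbl _ (N + 1)]
    · have := shiftsum (fun k => cchoose (-(i : ℤ) - 1) (k - (m + i + 1)) •
        (E ^ (k - (m + i + 1))) (C (g k))) (m + i + 1) (N + 1) (N + 1)
        (by intro p hp; rw [f_large hg _ (by omega)]; simp) (by omega)
      refine Eq.trans ?_ (this.trans ?_)
      · apply Finset.sum_congr rfl
        intro s _
        rw [Nat.add_sub_cancel_left, E_pow, Finset.smul_sum, ← Finset.Nat.sum_antidiagonal_swap]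
        apply Finset.sum_congr rfl
        rintro ⟨n, b⟩ hx
        rw [HasAntidiagonal.mem_antidiagonal] at hx
        simp only at hx
        subst hx
        simp only [Prod.fst_swap, Prod.snd_swap]
        rw [smul_smul, add_comm b n, Nat.choose_symm_add]
      · apply Finset.sum_congr rfl
        intro k _
        split_ifs <;> simp
    · intro a b hab
      rw [f_large hg _ (by omega), map_zero, DpIt_zero]; simp
  · intro k hk
    apply finsum_eq_zero_of_forall_eq_zero
    intro n
    unfold powLam
    rw [if_neg (by omega)]; simp

lemma R2_eq (f g : ℤ → V) (N : ℕ) (hf : IsDiffOpLE f N) (hg : IsDiffOpLE g N) (i j : ℕ) :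
    pmulP (shiftLam f) (dplusP (pmulP (powLam (-(i : ℤ) - 1)) (constP g))) (j : ℤ) =
      ∑ p ∈ range (N + 1), ∑ k ∈ range (N + 1),
      sr i j p k • Mb f g p k ((p : ℤ) + k - 1 - i - j).toNat := by
  rw [shiftmul _ _ (fun p => f p) (N + 1) (shiftLam_neg f N hf) (shiftLam_eq f N hf)]
  apply Finset.sum_congr rfl
  intro p _
  unfold sr
  simp only [Finset.sum_smul]
  rw [Finset.sum_comm, Finset.mul_sum]
  apply Finset.sum_congr rfl
  intro α hα
  rw [mem_range] at hα
  unfold dplusP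
  by_cases h : α ≤ j
  · rw [if_pos (by omega), show (j : ℤ) - α = ((j - α : ℕ) : ℤ) by omega, R2_inner g N hg,
      map_sum, Finset.smul_sum, Finset.mul_sum]
    apply Finset.sum_congr rfl
    intro k _
    by_cases hk : j - α + i + 1 ≤ k
    · rw [if_pos hk, if_pos ⟨h, hk⟩, map_smul, smul_smul, mul_smul_comm, ← Module.End.mul_apply,
        ← pow_add]
      unfold Mb
      congr 4
      omega
    · rw [if_neg hk, if_neg (by tauto)]; simp
  · rw [if_neg (by omega)]
    rw [Finset.sum_eq_zero]
    · simp
    · intro k _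
      rw [if_neg (by tauto)]; simp

end PDO

/-- For differential operators `A, B` of order at most `N`, the
expression `A(z) ι_z(z-w-λ-∂)⁻¹(B(w)) - A(∂+λ+w) ι_z(z-w-λ-∂)⁻¹(B*(λ-z))` equals
`Σ_{i,j=0}^{N-1} z^i w^j Res((A(∂+λ)(∂+λ)^(-i-1))₊ B(∂) ∂^(-j-1)
 - A(∂+λ)((∂+λ)^(-i-1) B(∂))₊ ∂^(-j-1))`;
in particular it is a polynomial in `z` and `w` of degree at most `N-1` in each
variable.  Both sides are written as their coefficient at `z^i w^j`. -/
theorem lemma_abc_i_eq_iii (V : Type*) [DiffSuperAlg V] (N : ℕ) (f g : ℤ → V)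
    (hf : PDO.IsDiffOpLE f N) (hg : PDO.IsDiffOpLE g N) (i j : ℤ) :
    PDO.iotaTermB f g i j - PDO.iotaTermA f g i j =
      if 0 ≤ i ∧ i < (N : ℤ) ∧ 0 ≤ j ∧ j < (N : ℤ) then
        PDO.resP (PDO.pmulP (PDO.pmulP
            (PDO.dplusP (PDO.pmulP (PDO.shiftLam f) (PDO.powLam (-i - 1))))
            (PDO.constP g)) (PDO.delP (-j - 1)))
        - PDO.resP (PDO.pmulP (PDO.pmulP (PDO.shiftLam f)
            (PDO.dplusP (PDO.pmulP (PDO.powLam (-i - 1)) (PDO.constP g))))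
            (PDO.delP (-j - 1)))
      else 0 := by
  by_cases hj : j < 0
  · have hB : PDO.iotaTermB f g i j = 0 := by
      unfold PDO.iotaTermB
      apply finsum_eq_zero_of_forall_eq_zero
      intro n
      rw [PDO.expW_eq, Finset.sum_eq_zero, mul_zero]
      intro α _
      rw [PDO.f_large hg _ (by omega)]; simp
    have hA : PDO.iotaTermA f g i j = 0 := by
      unfold PDO.iotaTermA
      apply finsum_eq_zero_of_forall_eq_zero
      intro n
      exact PDO.appW_neg f _ N hf j hj n
    rw [hA, hB, if_neg (by omega), sub_zero]
  · lift j to ℕ using (by omega)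
    by_cases h : 0 ≤ i ∧ i < (N : ℤ) ∧ 0 ≤ (j : ℤ) ∧ (j : ℤ) < (N : ℤ)
    · rw [if_pos h]
      lift i to ℕ using h.1
      rw [PDO.res_del, PDO.res_del, PDO.R1_eq f g N hf, PDO.R2_eq f g N hf hg,
        PDO.iotaA_eq f g N hf hg]
      congr 1
      apply Finset.sum_congr rfl
      intro p _
      apply Finset.sum_congr rfl
      intro k hk
      rw [Finset.mem_range] at hk
      rw [PDO.sc2 N i j p k (by omega)]
    · rw [if_neg h, sub_eq_zero, PDO.iotaA_eq f g N hf hg, PDO.iotaB_eq f g N hf hg]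
      apply Finset.sum_congr rfl
      intro p hp
      apply Finset.sum_congr rfl
      intro k hk
      rw [Finset.mem_range] at hk hp
      rw [PDO.sc4 N i j p k (by omega) (by omega) (by omega)]
end
end

section
/- Let g be a Lie superalgebra with an even supersymmetric invariant bilinear form (·|·) and k ∈ ℂ. The λ-bracket on the superalgebra of differential polynomials V(g) defined on generators by {a λ b} = [a,b] + kλ(a|b) for a,b ∈ g, and extended by the master formula, satisfies the skew-symmetry and Jacobi identity axioms, hence defines a Poisson vertex superalgebra structure (the affine PVsA of level k). -/
noncomputable section

namespace AffPV

open PDO Polynomial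

variable {V : Type*} [DiffSuperAlg V]

/-- The derivation as a linear map. -/
def DL : Module.End ℂ V where
  toFun := DiffSuperAlg.D
  map_add' := DiffSuperAlg.D_add
  map_smul' := DiffSuperAlg.D_smul

lemma DL_apply (v : V) : DL v = DiffSuperAlg.D v := rfl

lemma Dit_eq (n : ℕ) (v : V) : Dit n v = (DL ^ n) v := by
  rw [Module.End.pow_apply]; rfl

/-- Substitution of an operator for the variable. -/
def ev (T : Module.End ℂ V) : Polynomial V →ₗ[ℂ] V := Polynomial.lsum (fun n => T ^ n)

/-- Evaluation at a complex number. -/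
def ez (z : ℂ) : Polynomial V →ₗ[ℂ] V := ev (z • (1 : Module.End ℂ V))

/-- The operator `-z-∂`. -/
def Tz (z : ℂ) : Module.End ℂ V := -(z • (1 : Module.End ℂ V)) - DL

lemma Tz_apply (z : ℂ) (v : V) : Tz z v = -(z • v) - DL v := by simp [Tz]

lemma ev_monomial (T : Module.End ℂ V) (n : ℕ) (v : V) :
    ev T (monomial n v) = (T ^ n) v := by
  simp [ev, Polynomial.sum_monomial_index]

lemma ez_monomial (z : ℂ) (n : ℕ) (v : V) : ez z (monomial n v) = z ^ n • v := by
  rw [ez, ev_monomial, _root_.smul_pow, one_pow]; simp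

lemma ev_C (T : Module.End ℂ V) (v : V) : ev T (C v) = v := by
  rw [← monomial_zero_left, ev_monomial]; simp

lemma poly_ext {W : Type*} [AddCommGroup W] [Module ℂ W] (f g : Polynomial V →ₗ[ℂ] W)
    (h : ∀ n v, f (monomial n v) = g (monomial n v)) (P : Polynomial V) : f P = g P := by
  induction P using Polynomial.induction_on' with
  | add p q hp hq => rw [map_add, map_add, hp, hq]
  | monomial n v => exact h n v

/-- Separation: polynomials are determined by their values. -/
lemma ez_sep (P : Polynomial V) (h : ∀ z, ez z P = 0) : P = 0 := by
  ext m
  rw [coeff_zero, ← Module.forall_dual_apply_eq_zero_iff ℂ]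
  intro f
  let F : Polynomial V →ₗ[ℂ] Polynomial ℂ :=
    Polynomial.lsum (fun n => (Polynomial.monomial n).comp f)
  have hF : ∀ n v, F (monomial n v) = monomial n (f v) := by
    intro n v; simp [F, Polynomial.sum_monomial_index]
  have h1 : ∀ Q : Polynomial V, ∀ z, (F Q).eval z = f (ez z Q) := by
    intro Q z
    induction Q using Polynomial.induction_on' with
    | add p q hp hq => simp [hp, hq]
    | monomial n v => rw [hF, ez_monomial, eval_monomial]; simp [mul_comm]
  have h2 : ∀ Q : Polynomial V, (F Q).coeff m = f (Q.coeff m) := by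
    intro Q
    induction Q using Polynomial.induction_on' with
    | add p q hp hq => simp [hp, hq]
    | monomial n v => rw [hF, coeff_monomial, coeff_monomial]; split_ifs <;> simp
  have h3 : F P = 0 := by
    apply Polynomial.funext
    intro z
    rw [h1, h z]; simp
  rw [← h2, h3]; simp

lemma ez_inj (P Q : Polynomial V) (h : ∀ z, ez z P = ez z Q) : P = Q := by
  rw [← sub_eq_zero]
  exact ez_sep _ (fun z => by rw [map_sub, h z, sub_self])

lemma ev_X_mul (T : Module.End ℂ V) (P : Polynomial V) : ev T (X * P) = T (ev T P) := by
  induction P using Polynomial.induction_on' with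
  | add p q hp hq => rw [mul_add, map_add, hp, hq, map_add, map_add]
  | monomial n v => rw [X_mul_monomial, ev_monomial, ev_monomial, pow_succ']; rfl

lemma ez_X_mul (z : ℂ) (P : Polynomial V) : ez z (X * P) = z • ez z P := by
  rw [ez, ev_X_mul]; simp

lemma ez_mul_C (z : ℂ) (P : Polynomial V) (v : V) : ez z (P * C v) = ez z P * v := by
  induction P using Polynomial.induction_on' with
  | add p q hp hq => rw [add_mul, map_add, hp, hq, map_add, add_mul]
  | monomial n w => rw [monomial_mul_C, ez_monomial, ez_monomial, smul_mul_assoc]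

lemma ez_C_mul (z : ℂ) (P : Polynomial V) (v : V) : ez z (C v * P) = v * ez z P := by
  induction P using Polynomial.induction_on' with
  | add p q hp hq => rw [mul_add, map_add, hp, hq, map_add, mul_add]
  | monomial n w => rw [C_mul_monomial, ez_monomial, ez_monomial, mul_smul_comm]

/-- Coefficientwise application of a linear map. -/
def mapL (f : V →ₗ[ℂ] V) : Polynomial V →ₗ[ℂ] Polynomial V :=
  Polynomial.lsum (fun n => ((Polynomial.monomial n).restrictScalars ℂ).comp f)

lemma mapL_monomial (f : V →ₗ[ℂ] V) (n : ℕ) (v : V) :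
    mapL f (monomial n v) = monomial n (f v) := by
  simp [mapL, Polynomial.sum_monomial_index]

lemma mapL_coeff (f : V →ₗ[ℂ] V) (P : Polynomial V) (n : ℕ) :
    (mapL f P).coeff n = f (P.coeff n) := by
  induction P using Polynomial.induction_on' with
  | add p q hp hq => simp [hp, hq]
  | monomial k v => rw [mapL_monomial, coeff_monomial, coeff_monomial]; split_ifs <;> simp

lemma ev_mapL (f : V →ₗ[ℂ] V) (T T' : Module.End ℂ V) (h : ∀ v, f (T v) = T' (f v))
    (P : Polynomial V) : f (ev T P) = ev T' (mapL f P) := by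
  have hp : ∀ n v, f ((T ^ n) v) = (T' ^ n) (f v) := by
    intro n
    induction n with
    | zero => intro v; simp
    | succ n ih => intro v; rw [pow_succ, pow_succ, Module.End.mul_apply, ih, h]; rfl
  induction P using Polynomial.induction_on' with
  | add p q hp hq => rw [map_add, map_add, hp, hq, map_add, map_add]
  | monomial k v => rw [mapL_monomial, ev_monomial, ev_monomial, hp]

lemma ez_mapL (f : V →ₗ[ℂ] V) (z : ℂ) (P : Polynomial V) : f (ez z P) = ez z (mapL f P) :=
  ev_mapL f _ _ (by simp) P

lemma Dp_eq (P : Polynomial V) : Dp P = mapL DL P := by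
  rw [Dp, mapL, Polynomial.lsum_apply]
  refine Finset.sum_congr rfl fun n _ => ?_
  simp only [C_mul_X_pow_eq_monomial]; rfl

lemma ev_Dp (T : Module.End ℂ V) (h : ∀ v, DL (T v) = T (DL v)) (P : Polynomial V) :
    ev T (Dp P) = DL (ev T P) := by
  rw [Dp_eq, ev_mapL DL T T h]

lemma ez_Dp (z : ℂ) (P : Polynomial V) : ez z (Dp P) = DL (ez z P) :=
  ev_Dp _ (by simp) P

lemma Tz_comm (z : ℂ) (v : V) : DL (Tz z v) = Tz z (DL v) := by
  simp [Tz_apply]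

/-- Shift of the variable by a complex number. -/
def tay (z : ℂ) : Polynomial V →ₗ[ℂ] Polynomial V :=
  Polynomial.lsum (fun n => ∑ m ∈ Finset.range (n + 1),
    ((n.choose m : ℂ) * z ^ (n - m)) • (Polynomial.monomial m).restrictScalars ℂ)

lemma tay_monomial (z : ℂ) (n : ℕ) (v : V) : tay z (monomial n v) =
    ∑ m ∈ Finset.range (n + 1), ((n.choose m : ℂ) * z ^ (n - m)) • monomial m v := by
  simp [tay, Polynomial.sum_monomial_index]

lemma ev_tay (T : Module.End ℂ V) (z : ℂ) (P : Polynomial V) :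
    ev T (tay z P) = ev (T + z • (1 : Module.End ℂ V)) P := by
  induction P using Polynomial.induction_on' with
  | add p q hp hq => rw [map_add, map_add, hp, hq, map_add]
  | monomial n v =>
    have hc : Commute T (z • (1 : Module.End ℂ V)) := (Commute.one_right T).smul_right z
    rw [tay_monomial, map_sum, ev_monomial, hc.add_pow, LinearMap.sum_apply]
    refine Finset.sum_congr rfl fun m _ => ?_
    rw [map_smul, ev_monomial, _root_.smul_pow, one_pow]
    simp [Module.End.mul_apply, Module.End.natCast_apply, smul_smul, ← Nat.cast_smul_eq_nsmul ℂ,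
      mul_comm]

lemma ez_tay (w z : ℂ) (P : Polynomial V) : ez w (tay z P) = ez (z + w) P := by
  rw [ez, ev_tay, ← add_smul, add_comm, ez]

lemma finsum_tri {W : Type*} [AddCommMonoid W] (S : Finset ℕ) (G : ℕ → ℕ → W)
    (h : ∀ n, n ∉ S → ∀ m, G n m = 0) :
    (∑ᶠ (n : ℕ) (m : ℕ), if m ≤ n then G n m else 0)
      = ∑ n ∈ S, ∑ m ∈ Finset.range (n + 1), G n m := by
  have h1 : ∀ n, (∑ᶠ (m : ℕ), if m ≤ n then G n m else 0)
      = ∑ m ∈ Finset.range (n + 1), G n m := by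
    intro n
    rw [finsum_eq_sum_of_support_subset (s := Finset.range (n + 1))]
    · refine Finset.sum_congr rfl fun m hm => ?_
      rw [if_pos (by simpa [Nat.lt_succ_iff] using hm)]
    · intro m hm
      simp only [Function.mem_support, ne_eq, ite_eq_right_iff, Classical.not_imp] at hm
      simpa [Nat.lt_succ_iff] using hm.1
  simp only [h1]
  rw [finsum_eq_sum_of_support_subset]
  intro n hn
  by_contra hc
  apply hn
  exact Finset.sum_eq_zero fun m _ => h n hc m

lemma ev_eq_sum (T : Module.End ℂ V) (P : Polynomial V) :
    ev T P = ∑ n ∈ P.support, (T ^ n) (P.coeff n) := rfl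

lemma lamShift_eq (P : Polynomial V) (b : V) : lamShift P b =
    ∑ n ∈ P.support, ∑ m ∈ Finset.range (n + 1),
      (n.choose m : ℂ) • monomial (n - m) (P.coeff n * (DL ^ m) b) := by
  rw [lamShift, finsum_tri P.support]
  · refine Finset.sum_congr rfl fun n _ => Finset.sum_congr rfl fun m _ => ?_
    rw [X_pow_mul_C, C_mul_X_pow_eq_monomial, Dit_eq]
  · intro n hn m
    rw [notMem_support_iff.mp hn]; simp

lemma negLam_eq (P : Polynomial V) : negLam P =
    ∑ n ∈ P.support, ∑ m ∈ Finset.range (n + 1),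
      ((n.choose m : ℂ) * (-1) ^ n) • monomial (n - m) ((DL ^ m) (P.coeff n)) := by
  rw [negLam, finsum_tri P.support]
  · refine Finset.sum_congr rfl fun n _ => Finset.sum_congr rfl fun m _ => ?_
    rw [X_pow_mul_C, C_mul_X_pow_eq_monomial, Dit_eq]
  · intro n hn m
    rw [notMem_support_iff.mp hn, Dit_eq]; simp

/-- Binomial formula applied to a vector. -/
lemma add_pow_vec {W : Type*} [AddCommGroup W] [Module ℂ W] (S T : Module.End ℂ W)
    (h : Commute S T) (n : ℕ) (v : W) :
    ((S + T) ^ n) v = ∑ m ∈ Finset.range (n + 1), (n.choose m : ℂ) • (S ^ (n - m)) ((T ^ m) v) := by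
  rw [add_comm, h.symm.add_pow, LinearMap.sum_apply]
  refine Finset.sum_congr rfl fun m _ => ?_
  rw [(h.symm.pow_pow m (n - m)).eq]
  simp [Module.End.mul_apply, Module.End.natCast_apply, ← Nat.cast_smul_eq_nsmul ℂ]

lemma ev_negLam (T : Module.End ℂ V) (h : Commute T DL) (P : Polynomial V) :
    ev T (negLam P) = ev (-(T + DL)) P := by
  rw [negLam_eq, ev_eq_sum (-(T + DL)), map_sum]
  refine Finset.sum_congr rfl fun n _ => ?_
  have hneg : -(T + DL) = (-1 : ℂ) • (T + DL) := by
    ext v; simp [add_comm]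
  rw [map_sum, hneg, _root_.smul_pow, LinearMap.smul_apply, add_pow_vec T DL h, Finset.smul_sum]
  refine Finset.sum_congr rfl fun m _ => ?_
  rw [map_smul, ev_monomial, smul_smul, mul_comm]

lemma ez_negLam (z : ℂ) (P : Polynomial V) : ez z (negLam P) = ev (Tz z) P := by
  rw [ez, ev_negLam _ ((Commute.one_left _).smul_left z), neg_add', Tz]

lemma ev_Tz_negLam (z : ℂ) (P : Polynomial V) : ev (Tz z) (negLam P) = ez z P := by
  rw [ev_negLam, ez]
  · congr 1; simp [Tz]
  · ext v; exact (Tz_comm z v).symm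

lemma Tz_pow_mul (z : ℂ) (n : ℕ) (p b : V) : ((Tz z) ^ n) p * b =
    ∑ m ∈ Finset.range (n + 1),
      (n.choose m : ℂ) • ((Tz z) ^ (n - m)) (p * (DL ^ m) b) := by
  let S : Module.End ℂ (Module.End ℂ V) := LinearMap.mulLeft ℂ (Tz z)
  let R : Module.End ℂ (Module.End ℂ V) := LinearMap.mulRight ℂ DL
  have hSR : Commute S R := by
    ext f v; simp [S, R]
  have h1 : ∀ p : V, (S + R) (LinearMap.mulLeft ℂ p) = LinearMap.mulLeft ℂ (Tz z p) := by
    intro p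
    ext v
    simp [S, R, Tz_apply, DL_apply, DiffSuperAlg.D_mul, sub_mul]
    abel
  have h2 : ∀ n (p : V), ((S + R) ^ n) (LinearMap.mulLeft ℂ p)
      = LinearMap.mulLeft ℂ (((Tz z) ^ n) p) := by
    intro n
    induction n with
    | zero => intro p; simp
    | succ n ih => intro p; rw [pow_succ, pow_succ, Module.End.mul_apply, h1, ih]; rfl
  have h3 : ∀ n f, (S ^ n) f = (Tz z) ^ n * f := by
    intro n f; simp [S, LinearMap.pow_mulLeft]
  have h4 : ∀ n f, (R ^ n) f = f * DL ^ n := by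
    intro n f; simp [R, LinearMap.pow_mulRight]
  have h5 := congrArg (fun f : Module.End ℂ V => f b) (h2 n p)
  simp only [add_pow_vec S R hSR, h3, h4, LinearMap.mulLeft_apply] at h5
  rw [← h5, LinearMap.sum_apply]
  rfl

lemma ev_lamShift (z : ℂ) (P : Polynomial V) (b : V) :
    ev (Tz z) (lamShift P b) = ev (Tz z) P * b := by
  rw [lamShift_eq, ev_eq_sum _ P, map_sum, Finset.sum_mul]
  refine Finset.sum_congr rfl fun n _ => ?_
  rw [Tz_pow_mul, map_sum]
  refine Finset.sum_congr rfl fun m _ => ?_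
  rw [map_smul, ev_monomial]

/-! Signs. -/

lemma sgn_zero : sgn 0 = 1 := by simp [sgn]

lemma sgn_one : sgn 1 = -1 := by
  have : (1 : ZMod 2).val = 1 := rfl
  simp [sgn, this]

lemma zmod2_cases (x : ZMod 2) : x = 0 ∨ x = 1 := by
  revert x; decide

lemma sgn_add (x y : ZMod 2) : sgn (x + y) = sgn x * sgn y := by
  have h : (1 + 1 : ZMod 2) = 0 := rfl
  rcases zmod2_cases x with rfl | rfl <;> rcases zmod2_cases y with rfl | rfl <;>
    simp [sgn_zero, sgn_one, h]

lemma sgn_cases (x : ZMod 2) : sgn x = 1 ∨ sgn x = -1 := by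
  rcases zmod2_cases x with rfl | rfl <;> simp [sgn_zero, sgn_one]

abbrev gr (i : ZMod 2) : Submodule ℂ V := DiffSuperAlg.grading (V := V) i

lemma superComm_gr {i j : ZMod 2} {a b : V} (ha : a ∈ gr i) (hb : b ∈ gr j) :
    a * b = sgn (i * j) • (b * a) := by
  rw [DiffSuperAlg.superComm i j a ha b hb]
  congr 1
  rcases zmod2_cases i with rfl | rfl <;> rcases zmod2_cases j with rfl | rfl <;>
    simp [sgn, show (1 : ZMod 2).val = 1 from rfl]

lemma gr_mul {i j : ZMod 2} {a b : V} (ha : a ∈ gr i) (hb : b ∈ gr j) :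
    a * b ∈ gr (i + j) := by
  let _ := DiffSuperAlg.gradedAlgebra (V := V)
  exact SetLike.mul_mem_graded ha hb

lemma gr_one : (1 : V) ∈ gr 0 := by
  let _ := DiffSuperAlg.gradedAlgebra (V := V)
  exact SetLike.one_mem_graded _

lemma homog_induction {ι : Type*} (u : ι → V) (pu : ι → ZMod 2)
    (hu : ∀ i, u i ∈ gr (V := V) (pu i))
    (hgen : PDO.diffGen (Set.range u))
    (P : ZMod 2 → V → Prop)
    (hzero : ∀ i, P i 0)
    (hadd : ∀ i x y, P i x → P i y → P i (x + y))
    (hsmul : ∀ i (r : ℂ) x, P i x → P i (r • x))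
    (hone : P 0 1)
    (hD : ∀ i x, x ∈ gr i → P i x → P i (DiffSuperAlg.D x))
    (hmul : ∀ i j x y, x ∈ gr i → y ∈ gr j → P i x → P j y → P (i + j) (x * y))
    (huu : ∀ i, P (pu i) (u i)) (i : ZMod 2) (x : V) (hx : x ∈ gr i) : P i x := by
  let _ := DiffSuperAlg.gradedAlgebra (V := V)
  have key : ∀ x ∈ Submonoid.closure {x : V | ∃ v ∈ Set.range u, ∃ n : ℕ, x = Dit n v},
      ∃ p, x ∈ gr p ∧ P p x := by
    intro x hx
    induction hx using Submonoid.closure_induction with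
    | mem x h =>
      obtain ⟨_, ⟨s, rfl⟩, n, rfl⟩ := h
      refine ⟨pu s, ?_⟩
      induction n with
      | zero => exact ⟨hu s, huu s⟩
      | succ n ih =>
        have : Dit (n + 1) (u s) = DiffSuperAlg.D (Dit n (u s)) := by
          rw [Dit, Function.iterate_succ_apply']; rfl
        rw [this]
        exact ⟨DiffSuperAlg.D_even _ _ ih.1, hD _ _ ih.1 ih.2⟩
    | one => exact ⟨0, gr_one, hone⟩
    | mul x y _ _ h1 h2 =>
      obtain ⟨p, hp, hpp⟩ := h1
      obtain ⟨q, hq, hqq⟩ := h2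
      exact ⟨p + q, gr_mul hp hq, hmul _ _ _ _ hp hq hpp hqq⟩
  have hxm : x ∈ Submodule.span ℂ (Submonoid.closure
      {x : V | ∃ v ∈ Set.range u, ∃ n : ℕ, x = Dit n v} : Set V) := by
    rw [← Algebra.adjoin_eq_span, hgen]; trivial
  have main : ∀ i, P i ((DirectSum.decompose (DiffSuperAlg.grading (V := V)) x) i : V) := by
    clear hx
    intro i
    induction hxm using Submodule.span_induction with
    | mem x h =>
      obtain ⟨p, hp, hpp⟩ := key x h
      by_cases hpi : p = i
      · subst hpi
        rw [DirectSum.decompose_of_mem_same _ hp]; exact hpp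
      · rw [DirectSum.decompose_of_mem_ne _ hp hpi]; exact hzero i
    | zero => simpa using hzero i
    | add x y _ _ h1 h2 => simpa using hadd i _ _ h1 h2
    | smul r x _ h => 
      rw [DirectSum.decompose_smul]; exact hsmul i r _ h
  have := main i
  rwa [DirectSum.decompose_of_mem_same _ hx] at this

/-! Brackets. -/

/-- The bracket as a bilinear map. -/
def brL (B : LambdaBracket V) : V →ₗ[ℂ] V →ₗ[ℂ] Polynomial V :=
  LinearMap.mk₂ ℂ B.br B.add_left B.smul_left B.add_right
    (fun c a b => B.smul_right c a b)

/-- The bracket evaluated at a complex number. -/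
def op (B : LambdaBracket V) (z : ℂ) : V →ₗ[ℂ] V →ₗ[ℂ] V := (brL B).compr₂ (ez z)

variable (B : LambdaBracket V)

lemma op_apply (z : ℂ) (a b : V) : op B z a b = ez z (B.br a b) := rfl

lemma op_D_left (z : ℂ) (a b : V) : op B z (DL a) b = -(z • op B z a b) := by
  rw [op_apply, DL_apply, B.sesq_left, map_neg, ez_X_mul, op_apply]

lemma op_D_right (z : ℂ) (a b : V) :
    op B z a (DL b) = z • op B z a b + DL (op B z a b) := by
  rw [op_apply, DL_apply, B.sesq_right, map_add, ez_X_mul, op_apply, ez_Dp]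

lemma op_mul (z : ℂ) {i j : ZMod 2} {a b : V} (ha : a ∈ gr i) (hb : b ∈ gr j) (c : V) :
    op B z a (b * c) = op B z a b * c + sgn (i * j) • (b * op B z a c) := by
  rw [op_apply, B.leibniz_left i j a ha b hb, map_add, map_smul, ez_mul_C, ez_C_mul]; rfl

lemma op_mem (z : ℂ) {i j : ZMod 2} {a b : V} (ha : a ∈ gr i) (hb : b ∈ gr j) :
    op B z a b ∈ gr (i + j) := by
  rw [op_apply, ez, ev_eq_sum]
  refine Submodule.sum_mem _ fun n _ => ?_
  rw [_root_.smul_pow, one_pow]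
  exact Submodule.smul_mem _ _ (B.even i j a ha b hb n)

lemma op_one_right (z : ℂ) {i : ZMod 2} {a : V} (ha : a ∈ gr i) : op B z a 1 = 0 := by
  have := op_mul B z ha gr_one 1
  simpa [sgn_zero] using this

lemma DL_one : DL (1 : V) = 0 := by
  have := DiffSuperAlg.D_mul (1 : V) 1
  simpa [DL_apply] using this

lemma ev_br_mul (z : ℂ) {i j k : ZMod 2} {a b c : V} (ha : a ∈ gr i) (hb : b ∈ gr j)
    (hc : c ∈ gr k) : ev (Tz z) (B.br (a * b) c) =
      sgn (j * k) • (ev (Tz z) (B.br a c) * b)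
        + sgn (i * (j + k)) • (ev (Tz z) (B.br b c) * a) := by
  rw [B.leibniz_right i j k a ha b hb c hc, map_add, map_smul, map_smul, ev_lamShift, ev_lamShift]

lemma ev_br_one (z : ℂ) {k : ZMod 2} {c : V} (hc : c ∈ gr k) :
    ev (Tz z) (B.br 1 c) = 0 := by
  have := ev_br_mul B z gr_one gr_one hc
  simpa [sgn_zero] using this

/-- Skew-symmetry of a pair. -/
def SK (i j : ZMod 2) (a b : V) : Prop :=
  ∀ z, op B z a b = -(sgn (i * j) • ev (Tz z) (B.br b a))

lemma SK_poly {i j : ZMod 2} {a b : V} (h : SK B i j a b) :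
    B.br a b = -(sgn (i * j) • negLam (B.br b a)) := by
  apply ez_inj
  intro z
  rw [map_neg, map_smul, ez_negLam]
  exact h z

lemma SK_flip {i j : ZMod 2} {a b : V} (h : SK B i j a b) : SK B j i b a := by
  intro z
  rw [SK_poly B h, map_neg, map_smul, ev_Tz_negLam, op_apply, mul_comm j i]
  rcases sgn_cases (i * j) with h | h <;> simp [h]

lemma SK_induct {ι : Type*} (u : ι → V) (pu : ι → ZMod 2)
    (hu : ∀ i, u i ∈ gr (V := V) (pu i))
    (hgen : PDO.diffGen (Set.range u)) {i : ZMod 2} {a : V} (ha : a ∈ gr i)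
    (hs : ∀ s, SK B i (pu s) a (u s)) (j : ZMod 2) (b : V) (hb : b ∈ gr j) : SK B i j a b := by
  have e1 : ∀ z (x y : V), ev (Tz z) (B.br (x + y) a)
      = ev (Tz z) (B.br x a) + ev (Tz z) (B.br y a) := fun z x y => by
    rw [B.add_left, map_add]
  have e2 : ∀ z (r : ℂ) (x : V), ev (Tz z) (B.br (r • x) a)
      = r • ev (Tz z) (B.br x a) := fun z r x => by
    rw [B.smul_left, map_smul]
  refine homog_induction u pu hu hgen (fun j b => SK B i j a b) ?_ ?_ ?_ ?_ ?_ ?_ hs j b hb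
  · intro j z
    have := e2 z 0 0
    rw [zero_smul, zero_smul] at this
    rw [this]; simp
  · intro j x y hx hy z
    rw [map_add, hx z, hy z, e1, smul_add]; abel
  · intro j r x hx z
    rw [map_smul, hx z, e2, smul_neg, smul_comm]
  · intro z
    rw [op_one_right B z ha, ev_br_one B z ha]; simp
  · intro j x _ hx z
    rw [← DL_apply, op_D_right, hx z, DL_apply x, B.sesq_left, map_neg (ev _), ev_X_mul, Tz_apply]
    simp only [map_neg, map_smul, smul_sub, smul_neg]
    rw [smul_comm z]
    abel
  · intro j k x y hx hy h1 h2 z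
    rw [op_mul B z ha hx, ev_br_mul B z hx hy ha,
      superComm_gr hx (op_mem B z ha hy), h1 z, h2 z, mul_add, mul_add, mul_add, sgn_add,
      sgn_add, sgn_add, mul_comm k i, mul_comm j i]
    rcases sgn_cases (i * j) with h | h <;> rcases sgn_cases (i * k) with hb1 | hb1 <;>
    rcases sgn_cases (j * k) with hb2 | hb2 <;> simp [h, hb1, hb2] <;> abel

/-- Jacobi identity for a triple. -/
def JA (i j : ZMod 2) (a b c : V) : Prop :=
  ∀ z w, op B z a (op B w b c) =
    op B (z + w) (op B z a b) c + sgn (i * j) • op B w b (op B z a c)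

lemma JA_induct {ι : Type*} (u : ι → V) (pu : ι → ZMod 2)
    (hu : ∀ i, u i ∈ gr (V := V) (pu i))
    (hgen : PDO.diffGen (Set.range u)) {i j : ZMod 2} {a b : V} (ha : a ∈ gr i) (hb : b ∈ gr j)
    (hs : ∀ s, JA B i j a b (u s)) (k : ZMod 2) (c : V) (hc : c ∈ gr k) : JA B i j a b c := by
  refine homog_induction u pu hu hgen (fun _ c => JA B i j a b c) ?_ ?_ ?_ ?_ ?_ ?_ hs k c hc
  · intro j z w
    simp
  · intro j x y hx hy z w
    simp only [map_add]
    rw [hx z w, hy z w, smul_add]; abel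
  · intro j r x hx z w
    simp only [map_smul]
    rw [hx z w, smul_add, smul_comm r]
  · intro z w
    rw [op_one_right B _ ha, op_one_right B _ hb, op_one_right B _ (op_mem B z ha hb)]; simp
  · intro k x _ hx z w
    rw [← DL_apply]
    simp only [op_D_right, map_add, map_smul]
    rw [hx z w]
    simp only [smul_add, map_add, map_smul, add_smul]
    rw [smul_comm z (sgn (i * j)), smul_comm w (sgn (i * j))]
    abel
  · intro k l x y hx hy h1 h2 z w
    rw [op_mul B w hb hx, op_mul B z ha hx, op_mul B _ (op_mem B z ha hb) hx]
    simp only [map_add, map_smul]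
    rw [op_mul B z ha (op_mem B w hb hx), op_mul B z ha hx, op_mul B w hb (op_mem B z ha hx),
      op_mul B w hb hx, h1 z w, h2 z w, mul_add i, mul_add j, add_mul i j k, sgn_add, sgn_add, sgn_add,
      mul_comm j i]
    simp only [mul_add, add_mul]
    rcases sgn_cases (i * j) with h | h <;> rcases sgn_cases (i * k) with hb1 | hb1 <;>
    rcases sgn_cases (j * k) with hb2 | hb2 <;> simp [h, hb1, hb2] <;> abel

lemma JA_swap12 {i j : ZMod 2} {a b c : V} (hs : SK B i j a b) (h : JA B i j a b c) :
    JA B j i b a c := by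
  intro z w
  have h1 : ∀ P : Polynomial V, op B (w + z) (ev (Tz w) P) c = op B (z + w) (ez z P) c := by
    intro P
    have hp : ∀ n v, op B (w + z) ((Tz w ^ n) v) c = z ^ n • op B (w + z) v c := by
      intro n
      induction n with
      | zero => intro v; simp
      | succ n ih =>
        intro v
        rw [pow_succ, Module.End.mul_apply, ih, Tz_apply, map_sub, map_neg, map_smul,
          LinearMap.sub_apply, LinearMap.neg_apply, LinearMap.smul_apply, op_D_left, pow_succ,
          mul_smul]
        congr 1
        module
    induction P using Polynomial.induction_on' with
    | add p q hp hq => simp only [map_add, LinearMap.add_apply, hp, hq]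
    | monomial n v =>
      rw [ev_monomial, ez_monomial, hp, map_smul, add_comm w z]; rfl
  have h2 := h w z
  rw [hs w, map_neg, map_smul, LinearMap.neg_apply, LinearMap.smul_apply, h1,
    ← op_apply] at h2
  rw [h2, mul_comm j i]
  rcases sgn_cases (i * j) with h | h <;> simp [h]

lemma JA_poly {i j : ZMod 2} {a b c : V} (h : JA B i j a b c) (z : ℂ) :
    mapL (op B z a) (B.br b c) = tay z (B.br (op B z a b) c)
      + sgn (i * j) • B.br b (op B z a c) := by
  apply ez_inj
  intro w
  rw [← ez_mapL, map_add, map_smul, ez_tay]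
  exact h z w

lemma JA_swap23 {i j k : ZMod 2} {a b c : V} (ha : a ∈ gr i) (hb : b ∈ gr j) (hc : c ∈ gr k)
    (hs : ∀ (i j : ZMod 2) (a b : V), a ∈ gr i → b ∈ gr j → SK B i j a b)
    (h : JA B i j a b c) : JA B i k a c b := by
  intro z w
  have h1 : op B z a (ev (Tz w) (B.br b c))
      = ev (Tz (z + w)) (mapL (op B z a) (B.br b c)) := by
    apply ev_mapL
    intro v
    rw [Tz_apply, Tz_apply, map_sub, map_neg, map_smul, op_D_right]
    module
  have h2 : (Tz (z + w) : Module.End ℂ V) + z • (1 : Module.End ℂ V) = Tz w := by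
    simp only [Tz]; module
  rw [hs k j c b hc hb w, map_neg, map_smul, h1, JA_poly B h, map_add, map_smul, ev_tay, h2,
    hs _ _ _ _ (op_mem B z ha hc) hb (z + w), hs _ _ _ _ hc (op_mem B z ha hb) w,
    mul_add, add_mul, sgn_add, sgn_add, mul_comm k i]
  rcases sgn_cases (i * j) with h | h <;> rcases sgn_cases (i * k) with hb1 | hb1 <;>
    rcases sgn_cases (k * j) with hb2 | hb2 <;> simp [h, hb1, hb2]

lemma tay_coeff (z : ℂ) (m : ℕ) (P : Polynomial V) :
    (tay z P).coeff m = ez z (hasseDeriv m P) := by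
  induction P using Polynomial.induction_on' with
  | add p q hp hq => rw [map_add, map_add, map_add, coeff_add, hp, hq]
  | monomial n v =>
    rw [tay_monomial, hasseDeriv_monomial, ez_monomial, finsetSum_coeff]
    simp only [coeff_smul, coeff_monomial, smul_ite, smul_zero]
    rw [Finset.sum_ite_eq']
    split_ifs with hm
    · rw [← nsmul_eq_mul (_ : ℕ) v, ← Nat.cast_smul_eq_nsmul ℂ, smul_smul, mul_comm]
    · rw [Nat.choose_eq_zero_of_lt (by simpa using hm)]; simp

lemma JA_coeff {i j : ZMod 2} {a b c : V} (h : JA B i j a b c) (l m : ℕ) :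
    (B.br a ((B.br b c).coeff m)).coeff l =
      jacComp B a b c l m + sgn (i * j) • (B.br b ((B.br a c).coeff l)).coeff m := by
  let f3 : V →ₗ[ℂ] V := ((lcoeff V m).restrictScalars ℂ).comp (brL B b)
  let H : V →ₗ[ℂ] Polynomial V := ((hasseDeriv m).restrictScalars ℂ).comp ((brL B).flip c)
  let R2 : Polynomial V := ∑ n ∈ (B.br a b).support, X ^ n * H ((B.br a b).coeff n)
  have hX : ∀ z n (P : Polynomial V), ez z (X ^ n * P) = z ^ n • ez z P := by
    intro z n P
    induction n with
    | zero => simp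
    | succ n ih => rw [pow_succ', mul_assoc, ez_X_mul, ih, smul_smul, pow_succ']
  have hR2 : ∀ z, ez z R2 = ez z (H (op B z a b)) := by
    intro z
    rw [op_apply]
    rw [show ez z (B.br a b) = ∑ n ∈ (B.br a b).support,
      ((z • (1 : Module.End ℂ V)) ^ n) ((B.br a b).coeff n) from rfl, map_sum, map_sum, map_sum]
    refine Finset.sum_congr rfl fun n _ => ?_
    rw [hX, _root_.smul_pow, one_pow, LinearMap.smul_apply, map_smul, map_smul]; rfl
  have key : B.br a ((B.br b c).coeff m) = R2 + sgn (i * j) • mapL f3 (B.br a c) := by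
    apply ez_inj
    intro z
    have h1 := congrArg (fun P => P.coeff m) (JA_poly B h z)
    simp only [mapL_coeff, coeff_add, coeff_smul, tay_coeff] at h1
    rw [map_add, map_smul, ← ez_mapL, hR2]
    exact h1
  rw [key, coeff_add, coeff_smul, mapL_coeff]
  congr 1
  rw [jacComp, finsum_eq_sum_of_support_subset (s := (B.br a b).support)]
  · rw [finsetSum_coeff]
    refine Finset.sum_congr rfl fun n _ => ?_
    rw [coeff_X_pow_mul']
    split_ifs
    · change (hasseDeriv m (B.br ((B.br a b).coeff n) c)).coeff (l - n) = _
      rw [hasseDeriv_coeff, ← nsmul_eq_mul, ← Nat.cast_smul_eq_nsmul ℂ]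
    · rfl
  · intro n hn
    by_contra hc
    apply hn
    have h0 : B.br 0 c = 0 := by
      have := B.smul_left 0 0 c
      simpa using this
    have : (B.br a b).coeff n = 0 := by simpa using hc
    simp [this, h0]

end AffPV

/-- (Affine Poisson vertex superalgebra.)  Let `g` be a Lie
superalgebra with an even supersymmetric invariant bilinear form, realized inside a
differential superalgebra `V` by a homogeneous, differentially generating family
`u : ι → V` with structure constants `c` (so `[u i, u j] = Σ_l (c i j) l • u l`) and
form values `fm i j = (u i | u j)`, and let `k ∈ ℂ`.  If a λ-bracket `B` on `V`
satisfies `{u i _λ u j} = [u i, u j] + k λ (u i | u j)` on the generators, then `B`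
satisfies skew-symmetry and the Jacobi identity, hence defines a Poisson vertex
superalgebra structure on `V` (the affine PVsA of level `k`). -/
theorem affine_PVsA (V : Type*) [DiffSuperAlg V] {ι : Type*}
    (B : LambdaBracket V) (kc : ℂ)
    (u : ι → V) (pu : ι → ZMod 2)
    (hu : ∀ i, u i ∈ DiffSuperAlg.grading (V := V) (pu i))
    (hgen : PDO.diffGen (Set.range u))
    (c : ι → ι → ι →₀ ℂ) (fm : ι → ι → ℂ)
    -- skew-symmetry of the Lie superbracket
    (hlskew : ∀ i j : ι, (c i j).sum (fun l r => r • u l)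
        = -(PDO.sgn (pu i * pu j) • (c j i).sum (fun l r => r • u l)))
    -- Jacobi identity of the Lie superbracket
    (hljac : ∀ i j l : ι,
        (c j l).sum (fun s r => r • (c i s).sum fun t r' => r' • u t)
      = (c i j).sum (fun s r => r • (c s l).sum fun t r' => r' • u t)
        + PDO.sgn (pu i * pu j) •
            (c i l).sum (fun s r => r • (c j s).sum fun t r' => r' • u t))
    -- parity of the Lie superbracket
    (hlpar : ∀ i j l : ι, (c i j) l ≠ 0 → pu l = pu i + pu j)
    -- supersymmetry of the bilinear form
    (hsupsym : ∀ i j : ι, fm i j = PDO.sgn (pu i * pu j) * fm j i)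
    -- evenness of the bilinear form
    (heven : ∀ i j : ι, pu i ≠ pu j → fm i j = 0)
    -- invariance of the bilinear form
    (hinv : ∀ i j l : ι, (c i j).sum (fun s r => r * fm s l)
        = (c j l).sum fun s r => fm i s * r)
    -- the affine λ-bracket on generators
    (hbr : ∀ i j : ι, B.br (u i) (u j)
        = Polynomial.C ((c i j).sum fun l r => r • u l)
          + (kc * fm i j) • (Polynomial.X : Polynomial V)) :
    PDO.SkewSymm B ∧ PDO.Jacobi B := by
  classical
  let L : ι → ι → V := fun i j => (c i j).sum fun l r => r • u l
  have hop : ∀ z i j, AffPV.op B z (u i) (u j) = L i j + (z * (kc * fm i j)) • (1 : V) := by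
    intro z i j
    rw [AffPV.op_apply, hbr, map_add, map_smul, AffPV.ez, AffPV.ev_C, ← Polynomial.monomial_one_one_eq_X,
      AffPV.ev_monomial]
    simp [L, smul_smul, mul_comm]
  have hskgen : ∀ i j, AffPV.SK B (pu i) (pu j) (u i) (u j) := by
    intro i j z
    rw [hop, hbr, map_add, map_smul, AffPV.ev_C, ← Polynomial.monomial_one_one_eq_X,
      AffPV.ev_monomial, pow_one, AffPV.Tz_apply, AffPV.DL_one, hsupsym i j]
    simp only [L]
    rw [hlskew i j]
    module
  have hsk1 : ∀ s, ∀ j b, b ∈ AffPV.gr j → AffPV.SK B (pu s) j (u s) b := fun s =>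
    AffPV.SK_induct B u pu hu hgen (hu s) (hskgen s)
  have hsk : ∀ (i j : ZMod 2) (a b : V), a ∈ AffPV.gr i → b ∈ AffPV.gr j →
      AffPV.SK B i j a b := fun i j a b ha hb =>
    AffPV.SK_induct B u pu hu hgen ha (fun s => AffPV.SK_flip B (hsk1 s i a ha)) j b hb
  have hone : ∀ z l, AffPV.op B z 1 (u l) = 0 := by
    intro z l
    rw [hsk 0 (pu l) 1 (u l) AffPV.gr_one (hu l) z]
    have h1 : B.br (u l) 1 = 0 := AffPV.ez_sep _ fun w => AffPV.op_one_right B w (hu l)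
    rw [h1]; simp
  have hG1 : ∀ z i j l, AffPV.op B z (L i j) (u l) = (c i j).sum (fun s r => r • L s l)
      + (z * (kc * (c i j).sum fun s r => r * fm s l)) • (1 : V) := by
    intro z i j l
    simp only [L, Finsupp.sum, map_sum, map_smul, LinearMap.sum_apply, LinearMap.smul_apply]
    rw [Finset.mul_sum, Finset.mul_sum, Finset.sum_smul, ← Finset.sum_add_distrib]
    refine Finset.sum_congr rfl fun s _ => ?_
    rw [hop, smul_add, smul_smul]
    congr 2
    ring
  have hG2 : ∀ z i j l, AffPV.op B z (u i) (L j l) = (c j l).sum (fun s r => r • L i s)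
      + (z * (kc * (c j l).sum fun s r => fm i s * r)) • (1 : V) := by
    intro z i j l
    simp only [L, Finsupp.sum, map_sum, map_smul]
    rw [Finset.mul_sum, Finset.mul_sum, Finset.sum_smul, ← Finset.sum_add_distrib]
    refine Finset.sum_congr rfl fun s _ => ?_
    rw [hop, smul_add, smul_smul]
    congr 2
    ring
  have hPhi : ∀ i j l, (kc * (c i j).sum fun s r => r * fm s l) • (1 : V)
      = -(PDO.sgn (pu i * pu j) • (kc * (c j i).sum fun s r => r * fm s l) • (1 : V)) := by
    intro i j l
    have e : ∀ i j, AffPV.op B 1 (L i j) (u l) - AffPV.op B 0 (L i j) (u l)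
        = (kc * (c i j).sum fun s r => r * fm s l) • (1 : V) := by
      intro i j
      rw [hG1, hG1]; module
    have hL : L i j = -(PDO.sgn (pu i * pu j) • L j i) := hlskew i j
    rw [← e, ← e, hL]
    simp only [map_neg, map_smul, LinearMap.neg_apply, LinearMap.smul_apply]
    module
  have hjgen : ∀ i j l, AffPV.JA B (pu i) (pu j) (u i) (u j) (u l) := by
    intro i j l z w
    rw [hop w j l, hop z i j, hop z i l]
    simp only [map_add, map_smul, LinearMap.add_apply, LinearMap.smul_apply]
    rw [AffPV.op_one_right B z (hu i), AffPV.op_one_right B w (hu j), hone, hG1, hG2, hG2,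
      ← hinv i j l, ← hinv j i l]
    simp only [L]
    rw [hljac i j l]
    simp only [mul_smul, add_mul, add_smul, smul_zero, add_zero, smul_add]
    have h := hPhi i j l
    simp only [mul_smul] at h
    rw [h]
    module
  have hj1 : ∀ i j, ∀ k x, x ∈ AffPV.gr k → AffPV.JA B (pu i) (pu j) (u i) (u j) x :=
    fun i j => AffPV.JA_induct B u pu hu hgen (hu i) (hu j) (hjgen i j)
  have hj2 : ∀ i j y, y ∈ AffPV.gr j → ∀ k x, x ∈ AffPV.gr k →
      AffPV.JA B (pu i) j (u i) y x :=
    fun i j y hy => AffPV.JA_induct B u pu hu hgen (hu i) hy fun s =>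
      AffPV.JA_swap23 B (hu i) (hu s) hy hsk (hj1 i s j y hy)
  have hj3 : ∀ i a, a ∈ AffPV.gr i → ∀ j b, b ∈ AffPV.gr j → ∀ k x, x ∈ AffPV.gr k →
      AffPV.JA B i j a b x := by
    intro i a ha j b hb
    refine AffPV.JA_induct B u pu hu hgen ha hb fun s => ?_
    refine AffPV.JA_swap23 B ha (hu s) hb hsk ?_
    exact AffPV.JA_swap12 B (hsk _ _ _ _ (hu s) ha) (hj2 s i a ha j b hb)
  refine ⟨fun i j a ha b hb => AffPV.SK_poly B (hsk i j a b ha hb), ?_⟩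
  intro i j a ha b hb x l m
  apply AffPV.JA_coeff
  let _ := DiffSuperAlg.gradedAlgebra (V := V)
  induction x using DirectSum.Decomposition.inductionOn (DiffSuperAlg.grading (V := V)) with
  | zero => intro z w; simp
  | homogeneous x => exact hj3 i a ha j b hb _ _ x.2
  | add x y hx hy =>
    intro z w
    simp only [map_add]
    rw [hx z w, hy z w]; module
end
end
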